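/- arXiv:0906.3550 — 2 statements merged into one kernel-verified Lean document; each statement's English description precedes it below -/
import Mathlib

section
/- Let V : (0,2] → ℝ be defined by V(r) = ∑_{i=1}^{17} c_i P_i(t) + ∑_{i=1}^{29} P_{m_i}(t)/10⁶ + 10⁵·q(t)²/(1−t), where t = 1 − r²/2, with P_i, q, the exponents m_i, and the coefficients c_i as specified in the context. Then the regular 120-cell is the unique global minimizer of E_V among 600-point configurations on the unit sphere S³ ⊂ ℝ⁴: for every 600-point configuration C on S³, E_V(C) ≥ E_V(120-cell), and equality holds only if C is the image of the regular 120-cell configuration under an orthogonal transformation of ℝ⁴. -/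
open scoped Classical

/-- The `V`-potential energy of a finite configuration `C`:
`E_V(C) = (1/2) ∑_{x,y ∈ C, x ≠ y} V(|x-y|)`. -/
noncomputable def energy {n : ℕ} (V : ℝ → ℝ) (C : Finset (EuclideanSpace ℝ (Fin n))) : ℝ :=
  (1 / 2) * ∑ x ∈ C, ∑ y ∈ C, if x = y then 0 else V (dist x y)

/-- The distance distribution of a finite configuration: `d_C(r)` is the number of
unordered pairs of distinct points of `C` at Euclidean distance `r`. -/
noncomputable def distDistrib {n : ℕ} (C : Finset (EuclideanSpace ℝ (Fin n))) : ℝ → ℝ :=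
  fun r => ((C ×ˢ C).filter fun p => p.1 ≠ p.2 ∧ dist p.1 p.2 = r).card / 2

/-- `C` lies on the unit sphere `S^{n-1}`. -/
def onSphere {n : ℕ} (C : Finset (EuclideanSpace ℝ (Fin n))) : Prop :=
  ∀ x ∈ C, ‖x‖ = 1

/-- `C'` is the image of `C` under an orthogonal transformation of `ℝ^n`. -/
def isOrthImage {n : ℕ} (C C' : Finset (EuclideanSpace ℝ (Fin n))) : Prop :=
  ∃ O : EuclideanSpace ℝ (Fin n) ≃ₗᵢ[ℝ] EuclideanSpace ℝ (Fin n), C' = C.image O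

/-- The golden ratio. -/
noncomputable def phi : ℝ := (1 + Real.sqrt 5) / 2

/-- `±1` according to a sign bit. -/
def sgn (b : Bool) : ℝ := if b then 1 else -1

/-- All sign-changes of all permutations of the coordinates of `b`, scaled by `1/(2√2)`. -/
noncomputable def orbitAll (b : Fin 4 → ℝ) : Finset (EuclideanSpace ℝ (Fin 4)) :=
  Finset.image (fun p : Equiv.Perm (Fin 4) × (Fin 4 → Bool) =>
    (2 * Real.sqrt 2)⁻¹ • (WithLp.equiv 2 (Fin 4 → ℝ)).symm
      (fun i => sgn (p.2 i) * b (p.1 i))) Finset.univ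

/-- All sign-changes of all even permutations of the coordinates of `b`, scaled by
`1/(2√2)`. -/
noncomputable def orbitEven (b : Fin 4 → ℝ) : Finset (EuclideanSpace ℝ (Fin 4)) :=
  Finset.image (fun p : Equiv.Perm (Fin 4) × (Fin 4 → Bool) =>
    (2 * Real.sqrt 2)⁻¹ • (WithLp.equiv 2 (Fin 4 → ℝ)).symm
      (fun i => sgn (p.2 i) * b (p.1 i)))
    (Finset.univ.filter fun p : Equiv.Perm (Fin 4) × (Fin 4 → Bool) =>
      Equiv.Perm.sign p.1 = 1)

/-- The 600 vertices of the regular 120-cell on the unit sphere `S³`. -/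
noncomputable def cell120Config : Finset (EuclideanSpace ℝ (Fin 4)) :=
  orbitAll ![0, 0, 2, 2] ∪ orbitAll ![1, 1, 1, Real.sqrt 5] ∪
  orbitAll ![(phi ^ 2)⁻¹, phi, phi, phi] ∪ orbitAll ![phi⁻¹, phi⁻¹, phi⁻¹, phi ^ 2] ∪
  orbitEven ![0, (phi ^ 2)⁻¹, 1, phi ^ 2] ∪ orbitEven ![0, phi⁻¹, phi, Real.sqrt 5] ∪
  orbitEven ![phi⁻¹, 1, phi, 2]

/-- The monic polynomial whose roots are the inner products between distinct points of
the regular 120-cell. -/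
noncomputable def q120 : ℝ → ℝ := fun t =>
  t * (t + 1) * (4 * t + 1) * (4 * t - 1) * (4 * t + 3) * (4 * t - 3) *
    (2 * t + 1) * (2 * t - 1) * (16 * t ^ 2 - 5) *
    (4 * t ^ 2 + 2 * t - 1) * (4 * t ^ 2 - 2 * t - 1) *
    (16 * t ^ 2 + 4 * t - 1) * (16 * t ^ 2 - 4 * t - 1) *
    (16 * t ^ 2 + 4 * t - 11) * (16 * t ^ 2 - 4 * t - 11) *
    (16 * t ^ 2 + 12 * t + 1) * (16 * t ^ 2 - 12 * t + 1) *
    (16 * t ^ 2 + 20 * t + 5) * (16 * t ^ 2 - 20 * t + 5) / 2 ^ 50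

/-- The Gegenbauer polynomials for `S³`, normalized so `P i 1 = 1`:
`P i t = U i t / (i + 1)` with `U i` the Chebyshev polynomial of the second kind. -/
noncomputable def gegenP (i : ℕ) : ℝ → ℝ := fun t =>
  (Polynomial.Chebyshev.U ℝ (i : ℤ)).eval t / (i + 1)

/-- The coefficients `c₁, …, c₁₇` from Theorem 5. -/
noncomputable def c120 : ℕ → ℝ
  | 1 => 1 | 2 => 2 / 3 | 3 => 4 / 9 | 4 => 1 / 4 | 5 => 1 / 9
  | 6 => 1 / 20 | 7 => 1 / 20 | 8 => 1 / 15 | 9 => 1 / 15 | 10 => 9 / 200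
  | 11 => 3 / 190 | 12 => 0 | 13 => 7 / 900 | 14 => 1 / 40 | 15 => 1 / 35
  | 16 => 3 / 190 | 17 => 1 / 285 | _ => 0

/-- The exponents `m₁, …, m₂₉` from Theorem 5. -/
def m120 : Fin 29 → ℕ :=
  ![2, 4, 6, 8, 10, 14, 16, 18, 22, 26, 28, 34, 38, 46,
    1, 3, 5, 7, 9, 11, 13, 15, 17, 19, 21, 23, 25, 27, 29]

/-- The potential of Theorem 5 (the 120-cell theorem), as a function of the inner
product `t = 1 - r²/2`. -/
noncomputable def W120 : ℝ → ℝ := fun t =>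
  (∑ i ∈ Finset.Icc 1 17, c120 i * gegenP i t) +
    (∑ j : Fin 29, gegenP (m120 j) t / 10 ^ 6) +
    10 ^ 5 * q120 t ^ 2 / (1 - t)

/-- The potential of Theorem 5 (the 120-cell theorem). -/
noncomputable def V120 : ℝ → ℝ := fun r => W120 (1 - r ^ 2 / 2)

/-! ### A positive semidefinite pairing on polynomials -/

section Fischer

open MvPolynomial

variable {σ : Type*} [Fintype σ]

/-- The degree-`n` part of the Fischer inner product: the sum over all `n`-fold partial
derivatives of the product of their values at the origin. -/
noncomputable def fischer : ℕ → MvPolynomial σ ℝ → MvPolynomial σ ℝ → ℝ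
  | 0, p, q => constantCoeff p * constantCoeff q
  | n + 1, p, q => ∑ i, fischer n (pderiv i p) (pderiv i q)

theorem fischer_add_left (n : ℕ) (p p' q : MvPolynomial σ ℝ) :
    fischer n (p + p') q = fischer n p q + fischer n p' q := by
  induction n generalizing p p' q with
  | zero => simp [fischer, add_mul]
  | succ n ih => simp [fischer, ih, Finset.sum_add_distrib]

theorem fischer_C_mul_left (n : ℕ) (c : ℝ) (p q : MvPolynomial σ ℝ) :
    fischer n (C c * p) q = c * fischer n p q := by
  induction n generalizing p q with
  | zero => simp [fischer, mul_assoc]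
  | succ n ih => simp [fischer, ih, Finset.mul_sum]

theorem fischer_comm (n : ℕ) (p q : MvPolynomial σ ℝ) : fischer n p q = fischer n q p := by
  induction n generalizing p q with
  | zero => simp [fischer, mul_comm]
  | succ n ih => exact Finset.sum_congr rfl fun i _ => ih _ _

/-- The Fischer pairing as a linear map in its first argument. -/
noncomputable def fischerLeft (n : ℕ) (q : MvPolynomial σ ℝ) : MvPolynomial σ ℝ →ₗ[ℝ] ℝ where
  toFun p := fischer n p q
  map_add' p p' := fischer_add_left n p p' q
  map_smul' c p := by simp [← C_mul', fischer_C_mul_left]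

theorem fischer_sum_left {ι : Type*} (n : ℕ) (s : Finset ι) (p : ι → MvPolynomial σ ℝ)
    (q : MvPolynomial σ ℝ) : fischer n (∑ i ∈ s, p i) q = ∑ i ∈ s, fischer n (p i) q :=
  map_sum (fischerLeft n q) p s

theorem fischer_sub_left (n : ℕ) (p p' q : MvPolynomial σ ℝ) :
    fischer n (p - p') q = fischer n p q - fischer n p' q :=
  map_sub (fischerLeft n q) p p'

theorem fischer_zero_left (n : ℕ) (q : MvPolynomial σ ℝ) : fischer n 0 q = 0 :=
  map_zero (fischerLeft n q)

theorem fischer_zero_right (n : ℕ) (q : MvPolynomial σ ℝ) : fischer n q 0 = 0 := by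
  rw [fischer_comm, fischer_zero_left]

theorem fischer_self_nonneg (n : ℕ) (p : MvPolynomial σ ℝ) : 0 ≤ fischer n p p := by
  induction n generalizing p with
  | zero => exact mul_self_nonneg _
  | succ n ih => exact Finset.sum_nonneg fun i _ => ih _

theorem fischer_eq_zero_of_self (n : ℕ) (p q : MvPolynomial σ ℝ) (h : fischer n p p = 0) :
    fischer n p q = 0 := by
  induction n generalizing p q with
  | zero =>
    have : constantCoeff p = 0 := mul_self_eq_zero.mp h
    simp [fischer, this]
  | succ n ih =>
    rw [fischer, Finset.sum_eq_zero_iff_of_nonneg fun i _ => fischer_self_nonneg n _] at h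
    exact Finset.sum_eq_zero fun i hi => ih _ _ (h i hi)

theorem pderiv_pderiv_comm {ι : Type*} (i j : ι) (p : MvPolynomial ι ℝ) :
    pderiv i (pderiv j p) = pderiv j (pderiv i p) := by
  induction p using MvPolynomial.induction_on with
  | C a => simp
  | add p q hp hq => simp [hp, hq]
  | mul_X p k hp =>
    have h (a b : ι) : pderiv a (Pi.single (M := fun _ => MvPolynomial ι ℝ) b 1 k) = 0 := by
      by_cases hk : k = b
      · subst hk; simp
      · simp [hk]
    simp only [pderiv_mul, map_add, pderiv_X, hp, h]
    ring

theorem pderiv_two {ι : Type*} (i : ι) : pderiv i (2 : MvPolynomial ι ℝ) = 0 :=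
  pderiv_C (a := (2 : ℝ))

theorem fischer_X_mul (n : ℕ) (i : σ) (p q : MvPolynomial σ ℝ) :
    fischer (n + 1) (X i * p) q = (n + 1) * fischer n p (pderiv i q) := by
  have key (m : ℕ) (p q : MvPolynomial σ ℝ) : fischer (m + 1) (X i * p) q =
      fischer m p (pderiv i q) + ∑ j, fischer m (X i * pderiv j p) (pderiv j q) := by
    have h (j : σ) : pderiv j (X i * p) = Pi.single (M := fun _ => MvPolynomial σ ℝ) i p j
        + X i * pderiv j p := by
      rw [pderiv_mul, pderiv_X]
      by_cases hij : j = i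
      · subst hij; simp
      · simp [hij]
    simp only [fischer, h, fischer_add_left, Finset.sum_add_distrib]
    congr 1
    rw [Finset.sum_eq_single i]
    · simp
    · intro j _ hj
      simp [hj, fischer_zero_left]
    · simp
  induction n generalizing p q with
  | zero => rw [key]; simp [fischer]
  | succ n ih =>
    rw [key]
    simp only [ih, fun j => pderiv_pderiv_comm i j q, ← Finset.mul_sum]
    rw [show ∑ j, fischer n (pderiv j p) (pderiv j (pderiv i q)) =
      fischer (n + 1) p (pderiv i q) from rfl]
    push_cast
    ring

/-- The linear form `z ↦ ⟨y, z⟩`. -/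
noncomputable def linForm (y : σ → ℝ) : MvPolynomial σ ℝ := ∑ i, C (y i) * X i

/-- The squared norm, as a polynomial. -/
noncomputable def normSqPoly (σ : Type*) [Fintype σ] : MvPolynomial σ ℝ := ∑ i, X i * X i

/-- The directional derivative along `y`. -/
noncomputable def dirDeriv (y : σ → ℝ) (p : MvPolynomial σ ℝ) : MvPolynomial σ ℝ :=
  ∑ i, C (y i) * pderiv i p

/-- The Laplacian. -/
noncomputable def lapl (p : MvPolynomial σ ℝ) : MvPolynomial σ ℝ := ∑ i, pderiv i (pderiv i p)

/-- The Euler operator. -/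
noncomputable def euler (p : MvPolynomial σ ℝ) : MvPolynomial σ ℝ := ∑ i, X i * pderiv i p

theorem fischer_linForm_mul (n : ℕ) (y : σ → ℝ) (p q : MvPolynomial σ ℝ) :
    fischer (n + 1) (linForm y * p) q = (n + 1) * fischer n p (dirDeriv y q) := by
  rw [linForm, Finset.sum_mul, fischer_sum_left, dirDeriv, fischer_comm n p, fischer_sum_left,
    Finset.mul_sum]
  refine Finset.sum_congr rfl fun i _ => ?_
  rw [mul_assoc, fischer_C_mul_left, fischer_X_mul, fischer_C_mul_left, fischer_comm n p]
  ring

theorem fischer_normSqPoly_mul (n : ℕ) (p q : MvPolynomial σ ℝ) :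
    fischer (n + 2) (normSqPoly σ * p) q = (n + 2) * (n + 1) * fischer n p (lapl q) := by
  rw [normSqPoly, Finset.sum_mul, fischer_sum_left, lapl, fischer_comm n p, fischer_sum_left,
    Finset.mul_sum]
  refine Finset.sum_congr rfl fun i _ => ?_
  rw [mul_assoc, fischer_X_mul, fischer_X_mul, fischer_comm n p]
  push_cast
  ring

theorem lapl_dirDeriv (y : σ → ℝ) (p : MvPolynomial σ ℝ) :
    lapl (dirDeriv y p) = dirDeriv y (lapl p) := by
  simp only [lapl, dirDeriv, map_sum, pderiv_C_mul, Finset.mul_sum]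
  rw [Finset.sum_comm]
  refine Finset.sum_congr rfl fun i _ => Finset.sum_congr rfl fun j _ => ?_
  rw [pderiv_pderiv_comm j i p, pderiv_pderiv_comm j i]

theorem dirDeriv_add (y : σ → ℝ) (p q : MvPolynomial σ ℝ) :
    dirDeriv y (p + q) = dirDeriv y p + dirDeriv y q := by
  simp [dirDeriv, mul_add, Finset.sum_add_distrib]

theorem dirDeriv_sub (y : σ → ℝ) (p q : MvPolynomial σ ℝ) :
    dirDeriv y (p - q) = dirDeriv y p - dirDeriv y q := by
  simp [dirDeriv, mul_sub, Finset.sum_sub_distrib]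

theorem dirDeriv_mul (y : σ → ℝ) (p q : MvPolynomial σ ℝ) :
    dirDeriv y (p * q) = dirDeriv y p * q + p * dirDeriv y q := by
  simp only [dirDeriv, pderiv_mul, Finset.sum_mul, Finset.mul_sum, ← Finset.sum_add_distrib]
  exact Finset.sum_congr rfl fun i _ => by ring

theorem dirDeriv_linForm (y x : σ → ℝ) : dirDeriv y (linForm x) = C (∑ i, y i * x i) := by
  simp only [dirDeriv, linForm, map_sum, pderiv_C_mul, pderiv_X]
  refine Finset.sum_congr rfl fun i _ => ?_
  rw [Finset.sum_eq_single i] <;> simp +contextual [eq_comm]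

theorem pderiv_linForm (x : σ → ℝ) (i : σ) : pderiv i (linForm x) = C (x i) := by
  simp only [linForm, map_sum, pderiv_C_mul, pderiv_X]
  rw [Finset.sum_eq_single i] <;> simp +contextual [eq_comm]

theorem pderiv_normSqPoly (i : σ) : pderiv i (normSqPoly σ) = 2 * X i := by
  simp only [normSqPoly, map_sum, pderiv_mul, pderiv_X]
  rw [Finset.sum_eq_single i]
  · simp; ring
  · intro j _ hj
    simp [hj.symm]
  · simp

theorem dirDeriv_normSqPoly (y : σ → ℝ) : dirDeriv y (normSqPoly σ) = 2 * linForm y := by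
  simp only [dirDeriv, pderiv_normSqPoly, linForm, Finset.mul_sum]
  exact Finset.sum_congr rfl fun i _ => by ring

theorem euler_mul (p q : MvPolynomial σ ℝ) : euler (p * q) = euler p * q + p * euler q := by
  simp only [euler, pderiv_mul, Finset.sum_mul, Finset.mul_sum, ← Finset.sum_add_distrib]
  exact Finset.sum_congr rfl fun i _ => by ring

theorem euler_linForm (x : σ → ℝ) : euler (linForm x) = linForm x := by
  simp only [euler, pderiv_linForm]
  rw [linForm]
  exact Finset.sum_congr rfl fun i _ => by ring

theorem euler_normSqPoly : euler (normSqPoly σ) = 2 * normSqPoly σ := by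
  simp only [euler, pderiv_normSqPoly]
  rw [normSqPoly, Finset.mul_sum]
  exact Finset.sum_congr rfl fun i _ => by ring

theorem lapl_linForm_mul (x : σ → ℝ) (p : MvPolynomial σ ℝ) :
    lapl (linForm x * p) = 2 * dirDeriv x p + linForm x * lapl p := by
  simp only [lapl, dirDeriv, pderiv_mul, map_add, pderiv_linForm, pderiv_C, Finset.mul_sum,
    ← Finset.sum_add_distrib]
  exact Finset.sum_congr rfl fun i _ => by ring

theorem lapl_normSqPoly_mul (p : MvPolynomial σ ℝ) : lapl (normSqPoly σ * p) =
    2 * (Fintype.card σ : MvPolynomial σ ℝ) * p + 4 * euler p + normSqPoly σ * lapl p := by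
  have h (i : σ) : pderiv i (pderiv i (normSqPoly σ * p)) =
      2 * p + 4 * (X i * pderiv i p) + normSqPoly σ * pderiv i (pderiv i p) := by
    simp only [pderiv_mul, map_add, pderiv_normSqPoly, pderiv_two, pderiv_X_self]
    ring
  simp only [lapl, h, Finset.sum_add_distrib, ← Finset.mul_sum, euler]
  simp
  ring

/-- Restriction to the line spanned by `y`. -/
noncomputable def lineRestrict (y : σ → ℝ) : MvPolynomial σ ℝ →ₐ[ℝ] Polynomial ℝ :=
  aeval fun i => Polynomial.C (y i) * Polynomial.X

theorem derivative_lineRestrict (y : σ → ℝ) (p : MvPolynomial σ ℝ) :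
    Polynomial.derivative (lineRestrict y p) = lineRestrict y (dirDeriv y p) := by
  induction p using MvPolynomial.induction_on with
  | C a => simp [lineRestrict, dirDeriv]
  | add p q hp hq => rw [map_add, map_add, hp, hq, dirDeriv_add, map_add]
  | mul_X p i hp =>
    have hX : dirDeriv y (X i : MvPolynomial σ ℝ) = C (y i) := by
      rw [dirDeriv, Finset.sum_eq_single i] <;> simp +contextual [pderiv_X, eq_comm]
    rw [map_mul, Polynomial.derivative_mul, hp, dirDeriv_mul, map_add, map_mul, map_mul, hX]
    simp [lineRestrict]

theorem eval_zero_lineRestrict {ι : Type*} (y : ι → ℝ) (p : MvPolynomial ι ℝ) :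
    (lineRestrict y p).eval 0 = constantCoeff p := by
  induction p using MvPolynomial.induction_on with
  | C a => simp [lineRestrict]
  | add p q hp hq => simp [hp, hq]
  | mul_X p i hp => simp [lineRestrict]

end Fischer

section Zonal

open MvPolynomial

/-- The zonal harmonic polynomial of degree `n` on `ℝ⁴` with pole `x`. -/
noncomputable def zonal (x : Fin 4 → ℝ) : ℕ → MvPolynomial (Fin 4) ℝ
  | 0 => 1
  | 1 => 2 * linForm x
  | n + 2 => 2 * linForm x * zonal x (n + 1) - normSqPoly (Fin 4) * zonal x n

theorem euler_zonal (x : Fin 4 → ℝ) (n : ℕ) : euler (zonal x n) = n * zonal x n := by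
  have h2 (p : MvPolynomial (Fin 4) ℝ) : euler (2 * p) = 2 * euler p := by
    simp [two_mul, euler, mul_add, Finset.sum_add_distrib]
  induction n using Nat.strong_induction_on with
  | _ n ih =>
    match n with
    | 0 => simp [zonal, euler]
    | 1 => simp [zonal, h2, euler_linForm]
    | n + 2 =>
      have hsub (p q : MvPolynomial (Fin 4) ℝ) : euler (p - q) = euler p - euler q := by
        simp [euler, mul_sub, Finset.sum_sub_distrib]
      rw [zonal, hsub, euler_mul, h2, euler_linForm, euler_mul, euler_normSqPoly,
        ih (n + 1) (by omega), ih n (by omega)]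
      push_cast
      ring

theorem dirDeriv_zonal {x : Fin 4 → ℝ} (hx : ∑ i, x i * x i = 1) (n : ℕ) :
    dirDeriv x (zonal x (n + 1)) = (n + 2) * zonal x n := by
  have h2 (p : MvPolynomial (Fin 4) ℝ) : dirDeriv x (2 * p) = 2 * dirDeriv x p := by
    simp only [two_mul, dirDeriv_add]
  have hl : dirDeriv x (linForm x) = 1 := by rw [dirDeriv_linForm, hx, C_1]
  induction n using Nat.strong_induction_on with
  | _ n ih =>
    match n with
    | 0 => simp [zonal, h2, hl]
    | 1 =>
      simp only [zonal, dirDeriv_sub, dirDeriv_mul, h2, hl, mul_assoc, dirDeriv_normSqPoly]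
      simp [dirDeriv]
      ring
    | n + 2 =>
      rw [zonal, dirDeriv_sub, dirDeriv_mul, h2, hl, dirDeriv_mul, dirDeriv_normSqPoly,
        ih (n + 1) (by omega), ih n (by omega), zonal]
      push_cast
      ring

theorem lapl_zonal {x : Fin 4 → ℝ} (hx : ∑ i, x i * x i = 1) (n : ℕ) :
    lapl (zonal x n) = 0 := by
  have h2 (p : MvPolynomial (Fin 4) ℝ) : lapl (2 * p) = 2 * lapl p := by
    simp [two_mul, lapl, Finset.sum_add_distrib]
  have hsub (p q : MvPolynomial (Fin 4) ℝ) : lapl (p - q) = lapl p - lapl q := by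
    simp [lapl, Finset.sum_sub_distrib]
  induction n using Nat.strong_induction_on with
  | _ n ih =>
    match n with
    | 0 => simp [zonal, lapl]
    | 1 => simp [zonal, lapl, pderiv_linForm, pderiv_two]
    | n + 2 =>
      rw [zonal, hsub, mul_assoc, h2, lapl_linForm_mul, lapl_normSqPoly_mul, dirDeriv_zonal hx,
        ih (n + 1) (by omega), ih n (by omega), euler_zonal]
      simp
      ring

theorem fischer_zonal (y : Fin 4 → ℝ) (n : ℕ) (q : MvPolynomial (Fin 4) ℝ) (hq : lapl q = 0) :
    fischer n (zonal y n) q = 2 ^ n * n.factorial * constantCoeff ((dirDeriv y)^[n] q) := by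
  induction n generalizing q with
  | zero => simp [zonal, fischer]
  | succ n ih =>
    have hD : lapl (dirDeriv y q) = 0 := by
      rw [lapl_dirDeriv, hq]; simp [dirDeriv]
    have h2 : (2 : MvPolynomial (Fin 4) ℝ) = C 2 := rfl
    have step : fischer (n + 1) (zonal y (n + 1)) q =
        2 * ((n + 1) * fischer n (zonal y n) (dirDeriv y q)) := by
      match n with
      | 0 =>
        rw [zonal, zonal, h2, fischer_C_mul_left, ← mul_one (linForm y), fischer_linForm_mul]
      | n + 1 =>
        rw [zonal, fischer_sub_left, fischer_normSqPoly_mul, hq, fischer_zero_right, mul_assoc, h2,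
          fischer_C_mul_left, fischer_linForm_mul]
        ring
    rw [step, ih _ hD, Function.iterate_succ_apply, Nat.factorial_succ]
    push_cast
    ring

theorem lineRestrict_zonal (x y : Fin 4 → ℝ) (hy : ∑ i, y i * y i = 1) (n : ℕ) :
    lineRestrict y (zonal x n) =
      Polynomial.C ((Polynomial.Chebyshev.U ℝ n).eval (∑ i, x i * y i)) * Polynomial.X ^ n := by
  have hl : lineRestrict y (linForm x) = Polynomial.C (∑ i, x i * y i) * Polynomial.X := by
    simp only [linForm, lineRestrict, map_sum, map_mul, aeval_X, aeval_C, Finset.sum_mul]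
    exact Finset.sum_congr rfl fun i _ => by simp; ring
  have hr : lineRestrict y (normSqPoly (Fin 4)) = Polynomial.X ^ 2 := by
    have : lineRestrict y (normSqPoly (Fin 4)) =
        Polynomial.C (∑ i, y i * y i) * Polynomial.X ^ 2 := by
      simp only [normSqPoly, lineRestrict, map_sum, map_mul, aeval_X, Finset.sum_mul]
      exact Finset.sum_congr rfl fun i _ => by ring
    rw [this, hy]; simp
  induction n using Nat.strong_induction_on with
  | _ n ih =>
    match n with
    | 0 => simp [zonal]
    | 1 =>
      rw [zonal, map_mul, hl, map_ofNat, ← mul_assoc, ← Polynomial.C_ofNat, ← map_mul]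
      simp
    | n + 2 =>
      rw [zonal, map_sub, map_mul, map_mul, map_mul, ih (n + 1) (by omega), ih n (by omega), hl, hr]
      have := Polynomial.Chebyshev.U_add_two ℝ (n : ℤ)
      push_cast
      rw [this]
      simp only [map_ofNat, Polynomial.eval_sub, Polynomial.eval_mul, Polynomial.eval_ofNat,
        Polynomial.eval_X, map_sub, map_mul]
      ring

theorem fischer_zonal_zonal {x y : Fin 4 → ℝ} (hx : ∑ i, x i * x i = 1)
    (hy : ∑ i, y i * y i = 1) (n : ℕ) : fischer n (zonal y n) (zonal x n) =
      2 ^ n * n.factorial ^ 2 * (Polynomial.Chebyshev.U ℝ n).eval (∑ i, x i * y i) := by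
  have h (p : MvPolynomial (Fin 4) ℝ) (k : ℕ) :
      lineRestrict y ((dirDeriv y)^[k] p) = Polynomial.derivative^[k] (lineRestrict y p) := by
    induction k generalizing p with
    | zero => rfl
    | succ k ih =>
      rw [Function.iterate_succ_apply, Function.iterate_succ_apply, ih, derivative_lineRestrict]
  rw [fischer_zonal y n _ (lapl_zonal hx n), ← eval_zero_lineRestrict y, h,
    lineRestrict_zonal x y hy, Polynomial.iterate_derivative_C_mul,
    Polynomial.iterate_derivative_X_pow_eq_smul]
  simp [Nat.descFactorial_self]
  ring

theorem sum_mul_self_of_norm_eq_one {x : EuclideanSpace ℝ (Fin 4)} (hx : ‖x‖ = 1) :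
    ∑ i, x i * x i = 1 := by
  have := EuclideanSpace.real_norm_sq_eq x
  rw [hx] at this
  simpa [sq] using this.symm

/-- The kernel `U_n(⟨x, y⟩)` on `S³`, as a Fischer pairing of zonal polynomials. -/
theorem chebyshevU_inner_eq {x y : EuclideanSpace ℝ (Fin 4)} (hx : ‖x‖ = 1) (hy : ‖y‖ = 1)
    (n : ℕ) : (Polynomial.Chebyshev.U ℝ n).eval (inner ℝ x y) =
      (2 ^ n * (n.factorial : ℝ) ^ 2)⁻¹ * fischer n (zonal x n) (zonal y n) := by
  rw [fischer_zonal_zonal (sum_mul_self_of_norm_eq_one hy) (sum_mul_self_of_norm_eq_one hx),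
    inv_mul_cancel_left₀ (by positivity)]
  simp [PiLp.inner_apply]

theorem sum_chebyshevU_inner_eq {C : Finset (EuclideanSpace ℝ (Fin 4))} (hC : onSphere C)
    {x : EuclideanSpace ℝ (Fin 4)} (hx : ‖x‖ = 1) (n : ℕ) :
    ∑ y ∈ C, (Polynomial.Chebyshev.U ℝ n).eval (inner ℝ x y) =
      (2 ^ n * (n.factorial : ℝ) ^ 2)⁻¹ * fischer n (∑ y ∈ C, zonal y n) (zonal x n) := by
  rw [fischer_sum_left, Finset.mul_sum]
  refine Finset.sum_congr rfl fun y hy => ?_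
  rw [real_inner_comm, chebyshevU_inner_eq (hC y hy) hx]

theorem sum_sum_chebyshevU_inner_eq {C : Finset (EuclideanSpace ℝ (Fin 4))} (hC : onSphere C)
    (n : ℕ) : ∑ x ∈ C, ∑ y ∈ C, (Polynomial.Chebyshev.U ℝ n).eval (inner ℝ x y) =
      (2 ^ n * (n.factorial : ℝ) ^ 2)⁻¹ *
        fischer n (∑ y ∈ C, zonal y n) (∑ y ∈ C, zonal y n) := by
  rw [fischer_comm, fischer_sum_left, Finset.mul_sum]
  refine Finset.sum_congr rfl fun x hx => ?_
  rw [sum_chebyshevU_inner_eq hC (hC x hx), fischer_comm]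

theorem sum_sum_chebyshevU_nonneg {C : Finset (EuclideanSpace ℝ (Fin 4))} (hC : onSphere C)
    (n : ℕ) : 0 ≤ ∑ x ∈ C, ∑ y ∈ C, (Polynomial.Chebyshev.U ℝ n).eval (inner ℝ x y) := by
  rw [sum_sum_chebyshevU_inner_eq hC]
  exact mul_nonneg (by positivity) (fischer_self_nonneg _ _)

theorem sum_chebyshevU_eq_zero {C : Finset (EuclideanSpace ℝ (Fin 4))} (hC : onSphere C) {n : ℕ}
    (h : ∑ x ∈ C, ∑ y ∈ C, (Polynomial.Chebyshev.U ℝ n).eval (inner ℝ x y) = 0)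
    {x : EuclideanSpace ℝ (Fin 4)} (hx : ‖x‖ = 1) :
    ∑ y ∈ C, (Polynomial.Chebyshev.U ℝ n).eval (inner ℝ x y) = 0 := by
  rw [sum_sum_chebyshevU_inner_eq hC] at h
  have h0 := (mul_eq_zero.mp h).resolve_left (by positivity)
  rw [sum_chebyshevU_inner_eq hC hx, fischer_eq_zero_of_self _ _ _ h0, mul_zero]

end Zonal

/-! ### The vertices of the 120-cell over `ℤ[√5]` -/

section CellVertices

/-- The embedding of `ℤ[√5]` into the real numbers. -/
noncomputable def embR : ℤ√5 →+* ℝ := Zsqrtd.toReal (by norm_num : (0 : ℤ) ≤ 5)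

theorem embR_mk (a b : ℤ) : embR ⟨a, b⟩ = a + b * √5 := by
  simp [embR, Zsqrtd.toReal, Zsqrtd.lift_apply_apply]

theorem embR_injective : Function.Injective embR := by
  refine Zsqrtd.toReal_injective _ ?_
  rintro n h
  have h1 : n ≤ 2 := by nlinarith
  have h2 : -2 ≤ n := by nlinarith
  interval_cases n <;> simp at h

/-- Quadruples of elements of `ℤ[√5]`. -/
abbrev Quad : Type := ℤ√5 × ℤ√5 × ℤ√5 × ℤ√5

/-- `a` or `-a` according to a sign bit. -/
def signed (e : Bool) (a : ℤ√5) : ℤ√5 := if e then a else -a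

/-- A signed permutation of the quadruple `b`; the signs are attached to the entries of `b`. -/
def signedPerm (b : Fin 4 → ℤ√5) (σ : Equiv.Perm (Fin 4)) (ε : Fin 4 → Bool) : Quad :=
  (signed (ε (σ 0)) (b (σ 0)), signed (ε (σ 1)) (b (σ 1)), signed (ε (σ 2)) (b (σ 2)),
    signed (ε (σ 3)) (b (σ 3)))

/-- The permutations fixing `0` and cyclically permuting the other indices. -/
def threeCycles : List (Equiv.Perm (Fin 4)) :=
  [1, Equiv.swap 1 2 * Equiv.swap 2 3, Equiv.swap 2 3 * Equiv.swap 1 2]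

/-- The Klein four-group. -/
def kleinFour : List (Equiv.Perm (Fin 4)) :=
  [1, Equiv.swap 0 2 * Equiv.swap 1 3, Equiv.swap 0 1 * Equiv.swap 2 3,
    Equiv.swap 0 3 * Equiv.swap 1 2]

/-- The sign patterns whose first `k` signs are positive. -/
def signs (k : ℕ) : List (Fin 4 → Bool) :=
  ([true, false].flatMap fun a => [true, false].flatMap fun b => [true, false].flatMap fun c =>
    [true, false].map fun d => ![a, b, c, d]).filter
      fun ε => (List.finRange 4).all fun i => i.1 < k → ε i

/-- Twice the seven vectors generating the vertices of the 120-cell. -/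
def baseVec : Fin 7 → Fin 4 → ℤ√5
  | 0 => ![⟨0, 0⟩, ⟨0, 0⟩, ⟨4, 0⟩, ⟨4, 0⟩]
  | 1 => ![⟨2, 0⟩, ⟨2, 0⟩, ⟨2, 0⟩, ⟨0, 2⟩]
  | 2 => ![⟨3, -1⟩, ⟨1, 1⟩, ⟨1, 1⟩, ⟨1, 1⟩]
  | 3 => ![⟨-1, 1⟩, ⟨-1, 1⟩, ⟨-1, 1⟩, ⟨3, 1⟩]
  | 4 => ![⟨0, 0⟩, ⟨3, -1⟩, ⟨2, 0⟩, ⟨3, 1⟩]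
  | 5 => ![⟨0, 0⟩, ⟨-1, 1⟩, ⟨1, 1⟩, ⟨0, 2⟩]
  | 6 => ![⟨-1, 1⟩, ⟨2, 0⟩, ⟨1, 1⟩, ⟨4, 0⟩]

/-- Even permutations which produce all the permutations of the base vector used in the
120-cell, each of them once. -/
def cosetReps : Fin 7 → List (Equiv.Perm (Fin 4))
  | 0 => (kleinFour.take 2).flatMap fun v => threeCycles.map fun c => v * c
  | 1 | 2 | 3 => kleinFour
  | _ => kleinFour.flatMap fun v => threeCycles.map fun c => v * c

/-- The number of vanishing entries of the base vectors. -/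
def numZeros : Fin 7 → ℕ
  | 0 => 2
  | 4 | 5 => 1
  | _ => 0

/-- The vertices of the 120-cell, multiplied by `4√2`. -/
def cellList : List Quad :=
  (List.finRange 7).flatMap fun k => (cosetReps k).flatMap fun σ =>
    (signs (numZeros k)).map fun ε => signedPerm (baseVec k) σ ε

theorem mem_cellList {q : Quad} : q ∈ cellList ↔
    ∃ k, ∃ σ ∈ cosetReps k, ∃ ε ∈ signs (numZeros k), signedPerm (baseVec k) σ ε = q := by
  simp [cellList]

/-- The inner product of quadruples. -/
def Quad.dot (p q : Quad) : ℤ√5 :=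
  p.1 * q.1 + p.2.1 * q.2.1 + p.2.2.1 * q.2.2.1 + p.2.2.2 * q.2.2.2

/-- Eight times the inner products of a vertex of the 120-cell with the vertices, together
with their multiplicities. -/
def ipDistr : List (ℤ√5 × ℕ) :=
  [(⟨8, 0⟩, 1), (⟨1, 3⟩, 4), (⟨5, 1⟩, 12), (⟨2, 2⟩, 24), (⟨6, 0⟩, 12), (⟨-1, 3⟩, 4), (⟨3, 1⟩, 24),
    (⟨0, 2⟩, 24), (⟨4, 0⟩, 32), (⟨1, 1⟩, 24), (⟨5, -1⟩, 12), (⟨-2, 2⟩, 24), (⟨2, 0⟩, 28),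
    (⟨-1, 1⟩, 24), (⟨3, -1⟩, 24), (⟨0, 0⟩, 54), (⟨-3, 1⟩, 24), (⟨1, -1⟩, 24), (⟨-2, 0⟩, 28),
    (⟨2, -2⟩, 24), (⟨-5, 1⟩, 12), (⟨-1, -1⟩, 24), (⟨-4, 0⟩, 32), (⟨0, -2⟩, 24), (⟨-3, -1⟩, 24),
    (⟨1, -3⟩, 4), (⟨-6, 0⟩, 12), (⟨-2, -2⟩, 24), (⟨-5, -1⟩, 12), (⟨-1, -3⟩, 4), (⟨-8, 0⟩, 1)]

/-- The representative of the `k`-th class of vertices of the 120-cell. -/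
def baseQuad (k : Fin 7) : Quad := signedPerm (baseVec k) 1 fun _ => true

theorem cellList_length : cellList.length = 600 := by decide +kernel

/-- Whether the numbers in a list are distinct and not among the set bits of `n`. -/
def distinctFrom : ℕ → List ℕ → Bool
  | _, [] => true
  | n, a :: l => !n.testBit a && distinctFrom (n ||| 2 ^ a) l

theorem nodup_of_distinctFrom {n : ℕ} {l : List ℕ} (h : distinctFrom n l = true) :
    l.Nodup ∧ ∀ a ∈ l, n.testBit a = false := by
  induction l generalizing n with
  | nil => simp
  | cons a l ih =>
    simp only [distinctFrom, Bool.and_eq_true, Bool.not_eq_true'] at h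
    obtain ⟨h1, h2⟩ := ih h.2
    simp only [Nat.testBit_or, Bool.or_eq_false_iff] at h2
    refine ⟨List.nodup_cons.2 ⟨fun ha => ?_, h1⟩, ?_⟩
    · simpa using (h2 a ha).2
    · simpa using ⟨h.1, fun b hb => (h2 b hb).1⟩

/-- A hash function which is injective on the vertices of the 120-cell. -/
def Quad.hash (q : Quad) : ℕ :=
  ((6800 * q.1.re + 7457 * q.1.im + 5492 * q.2.1.re + 1556 * q.2.1.im + 2486 * q.2.2.1.re +
    2328 * q.2.2.1.im + 4814 * q.2.2.2.re + 7975 * q.2.2.2.im) % 8192).toNat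

theorem cellList_nodup : cellList.Nodup := by
  have h : distinctFrom 0 (cellList.map Quad.hash) = true := by decide +kernel
  exact (nodup_of_distinctFrom h).1.of_map

theorem map_dot_cellList_perm (k : Fin 7) :
    List.Perm (ipDistr.flatMap fun s => List.replicate s.2 (⟨4, 0⟩ * s.1))
      (cellList.map (Quad.dot (baseQuad k))) := by
  have h : ∀ k : Fin 7, ∀ s ∈ ipDistr,
      (cellList.map (Quad.dot (baseQuad k))).count (⟨4, 0⟩ * s.1) = s.2 := by decide +kernel
  have h' : ∀ s ∈ ipDistr, (ipDistr.flatMap fun s => List.replicate s.2 (⟨4, 0⟩ * s.1)).count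
      (⟨4, 0⟩ * s.1) = s.2 := by decide +kernel
  have hl : (ipDistr.flatMap fun s => List.replicate s.2 (⟨4, 0⟩ * s.1)).length = 600 := by
    decide +kernel
  refine List.Subperm.perm_of_length_le ?_ (by rw [hl, List.length_map, cellList_length])
  rw [List.subperm_ext_iff]
  intro x hx
  obtain ⟨s, hs, hx⟩ := List.mem_flatMap.1 hx
  rw [List.eq_of_mem_replicate hx, h k s hs, h' s hs]

/-- The point of space with the given coordinates, scaled. -/
noncomputable def Quad.toPoint (q : Quad) : EuclideanSpace ℝ (Fin 4) :=
  (4 * √2)⁻¹ • WithLp.toLp 2 ![embR q.1, embR q.2.1, embR q.2.2.1, embR q.2.2.2]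

theorem Quad.inner_toPoint (p q : Quad) :
    inner ℝ p.toPoint q.toPoint = embR (p.dot q) / 32 := by
  have h2 : √2 * √2 = 2 := Real.mul_self_sqrt (by norm_num)
  have h3 : √2 ≠ 0 := by positivity
  simp only [Quad.toPoint, inner_smul_left, inner_smul_right, Quad.dot, map_add, map_mul]
  simp [PiLp.inner_apply, Fin.sum_univ_four]
  field_simp
  linear_combination (-16 * (embR p.1 * embR q.1 + embR p.2.1 * embR q.2.1 +
    embR p.2.2.1 * embR q.2.2.1 + embR p.2.2.2 * embR q.2.2.2)) * h2

theorem Quad.toPoint_injective : Function.Injective Quad.toPoint := by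
  intro p q h
  have h3 : (4 * √2)⁻¹ ≠ 0 := by positivity
  have h4 := (WithLp.toLp_injective 2) (smul_right_injective _ h3 h)
  have e (i : Fin 4) := congrFun h4 i
  have e0 := embR_injective (e 0)
  have e1 := embR_injective (e 1)
  have e2 := embR_injective (e 2)
  have e3 := embR_injective (e 3)
  exact Prod.ext e0 (Prod.ext e1 (Prod.ext e2 e3))

/-- The point obtained from a real vector by a signed permutation. -/
noncomputable def signedPoint (b : Fin 4 → ℝ) (σ : Equiv.Perm (Fin 4)) (δ : Fin 4 → Bool) :
    EuclideanSpace ℝ (Fin 4) :=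
  (2 * √2)⁻¹ • (WithLp.equiv 2 (Fin 4 → ℝ)).symm (fun i => sgn (δ i) * b (σ i))

/-- The real generating vectors. -/
noncomputable def baseReal (k : Fin 7) (i : Fin 4) : ℝ := embR (baseVec k i) / 2

theorem embR_signed (e : Bool) (a : ℤ√5) : embR (signed e a) = sgn e * embR a := by
  cases e <;> simp [signed, sgn]

theorem signedPoint_eq_toPoint {k : Fin 7} {σ τ : Equiv.Perm (Fin 4)} {δ ε : Fin 4 → Bool}
    (h : ∀ i, signed (δ i) (baseVec k (σ i)) = signed (ε (τ i)) (baseVec k (τ i))) :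
    signedPoint (baseReal k) σ δ = (signedPerm (baseVec k) τ ε).toPoint := by
  have h' (i : Fin 4) : sgn (δ i) * baseReal k (σ i) =
      embR (signed (ε (τ i)) (baseVec k (τ i))) / 2 := by
    rw [← h, embR_signed, baseReal, mul_div_assoc]
  simp only [signedPoint, Quad.toPoint, h', signedPerm]
  ext i
  fin_cases i <;> simp <;> ring

theorem exists_cosetRep : ∀ (k : Fin 7) (σ : Equiv.Perm (Fin 4)), (k < 4 ∨ Equiv.Perm.sign σ = 1) →
    ∃ τ ∈ cosetReps k, ∀ i, baseVec k (σ i) = baseVec k (τ i) := by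
  decide +kernel

theorem sign_cosetRep : ∀ k, ∀ τ ∈ cosetReps k, Equiv.Perm.sign τ = 1 := by
  decide +kernel

theorem exists_signs : ∀ (k : Fin 7) (δ : Fin 4 → Bool), ∃ ε ∈ signs (numZeros k),
    ∀ i, signed (δ i) (baseVec k i) = signed (ε i) (baseVec k i) := by
  decide +kernel

theorem sqrt_five_sq : √(5 : ℝ) ^ 2 = 5 := Real.sq_sqrt (by norm_num)

theorem phi_sq : phi ^ 2 = (3 + √5) / 2 := by
  rw [phi]; linear_combination sqrt_five_sq / 4

theorem inv_phi : phi⁻¹ = (√5 - 1) / 2 := by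
  apply inv_eq_of_mul_eq_one_right
  rw [phi]; linear_combination sqrt_five_sq / 4

theorem inv_phi_sq : (phi ^ 2)⁻¹ = (3 - √5) / 2 := by
  apply inv_eq_of_mul_eq_one_right
  rw [phi_sq]; linear_combination -sqrt_five_sq / 4

theorem mem_cell120Config {x : EuclideanSpace ℝ (Fin 4)} : x ∈ cell120Config ↔
    ∃ k : Fin 7, ∃ σ δ, (k < 4 ∨ Equiv.Perm.sign σ = 1) ∧ signedPoint (baseReal k) σ δ = x := by
  have h0 : (![0, 0, 2, 2] : Fin 4 → ℝ) = baseReal 0 := by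
    ext i; fin_cases i <;> simp [baseReal, baseVec, embR_mk] <;> norm_num
  have h1 : (![1, 1, 1, √5] : Fin 4 → ℝ) = baseReal 1 := by
    ext i; fin_cases i <;> simp [baseReal, baseVec, embR_mk]
  have h2 : (![(phi ^ 2)⁻¹, phi, phi, phi] : Fin 4 → ℝ) = baseReal 2 := by
    rw [inv_phi_sq, phi]
    ext i; fin_cases i <;> simp [baseReal, baseVec, embR_mk]
    ring
  have h3 : (![phi⁻¹, phi⁻¹, phi⁻¹, phi ^ 2] : Fin 4 → ℝ) = baseReal 3 := by
    rw [inv_phi, phi_sq]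
    ext i; fin_cases i <;> simp [baseReal, baseVec, embR_mk] <;> ring
  have h4 : (![0, (phi ^ 2)⁻¹, 1, phi ^ 2] : Fin 4 → ℝ) = baseReal 4 := by
    rw [inv_phi_sq, phi_sq]
    ext i; fin_cases i <;> simp [baseReal, baseVec, embR_mk]
    ring
  have h5 : (![0, phi⁻¹, phi, √5] : Fin 4 → ℝ) = baseReal 5 := by
    rw [inv_phi, phi]
    ext i; fin_cases i <;> simp [baseReal, baseVec, embR_mk]
    ring
  have h6 : (![phi⁻¹, 1, phi, 2] : Fin 4 → ℝ) = baseReal 6 := by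
    rw [inv_phi, phi]
    ext i; fin_cases i <;> simp [baseReal, baseVec, embR_mk] <;> ring
  rw [cell120Config, h0, h1, h2, h3, h4, h5, h6]
  simp [Finset.mem_union, orbitAll, orbitEven, signedPoint, Fin.exists_fin_succ]

theorem mem_cell120Config_iff_toPoint {x : EuclideanSpace ℝ (Fin 4)} : x ∈ cell120Config ↔
    ∃ q ∈ cellList, q.toPoint = x := by
  rw [mem_cell120Config]
  constructor
  · rintro ⟨k, σ, δ, hσ, rfl⟩
    obtain ⟨τ, hτ, hστ⟩ := exists_cosetRep k σ hσ
    obtain ⟨ε, hε, hδε⟩ := exists_signs k (fun j => δ (τ.symm j))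
    refine ⟨_, mem_cellList.2 ⟨k, τ, hτ, ε, hε, rfl⟩, (signedPoint_eq_toPoint fun i => ?_).symm⟩
    rw [hστ, ← hδε]
    simp
  · rintro ⟨q, hq, rfl⟩
    obtain ⟨k, σ, hσ, ε, -, rfl⟩ := mem_cellList.1 hq
    exact ⟨k, σ, fun i => ε (σ i), Or.inr (sign_cosetRep k σ hσ),
      signedPoint_eq_toPoint fun i => rfl⟩

theorem cell120Config_eq_image : cell120Config = cellList.toFinset.image Quad.toPoint := by
  ext x
  simp [mem_cell120Config_iff_toPoint]

theorem card_cell120Config : cell120Config.card = 600 := by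
  rw [cell120Config_eq_image, Finset.card_image_of_injective _ Quad.toPoint_injective,
    List.toFinset_card_of_nodup cellList_nodup, cellList_length]

/-- A signed permutation of the coordinates. -/
noncomputable def coordMap (σ : Equiv.Perm (Fin 4)) (δ : Fin 4 → Bool)
    (v : EuclideanSpace ℝ (Fin 4)) : EuclideanSpace ℝ (Fin 4) :=
  WithLp.toLp 2 fun i => sgn (δ i) * v (σ i)

theorem sgn_mul_self (e : Bool) : sgn e * sgn e = 1 := by cases e <;> simp [sgn]

theorem inner_coordMap (σ : Equiv.Perm (Fin 4)) (δ : Fin 4 → Bool)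
    (v w : EuclideanSpace ℝ (Fin 4)) : inner ℝ (coordMap σ δ v) (coordMap σ δ w) = inner ℝ v w := by
  simp only [PiLp.inner_apply, coordMap]
  rw [← Equiv.sum_comp σ fun i => inner ℝ (v i) (w i)]
  refine Finset.sum_congr rfl fun i _ => ?_
  simp
  linear_combination (w (σ i) * v (σ i)) * sgn_mul_self (δ i)

theorem injective_of_inner_eq {E : Type*} [NormedAddCommGroup E] [InnerProductSpace ℝ E]
    {A : E → E} (hA : ∀ v w, inner ℝ (A v) (A w) = inner ℝ v w) : Function.Injective A := by
  intro v w h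
  rw [← sub_eq_zero, ← inner_self_eq_zero (𝕜 := ℝ)]
  simp only [inner_sub_left, inner_sub_right]
  rw [← hA v v, ← hA v w, ← hA w v, ← hA w w, h]
  ring

theorem coordMap_signedPoint (σ τ : Equiv.Perm (Fin 4)) (δ ε : Fin 4 → Bool) (b : Fin 4 → ℝ) :
    coordMap σ δ (signedPoint b τ ε) = signedPoint b (τ * σ) fun i => δ i == ε (σ i) := by
  ext i
  simp only [coordMap, signedPoint]
  cases h1 : δ i <;> cases h2 : ε (σ i) <;> simp [h1, h2, sgn]

theorem exists_symmetry {x : EuclideanSpace ℝ (Fin 4)} (hx : x ∈ cell120Config) :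
    ∃ k, ∃ A : EuclideanSpace ℝ (Fin 4) → EuclideanSpace ℝ (Fin 4),
      (∀ v w, inner ℝ (A v) (A w) = inner ℝ v w) ∧ x = A (baseQuad k).toPoint ∧
      cell120Config.image A = cell120Config := by
  obtain ⟨q, hq, rfl⟩ := mem_cell120Config_iff_toPoint.1 hx
  obtain ⟨k, σ, hσ, ε, -, rfl⟩ := mem_cellList.1 hq
  have hs := sign_cosetRep k σ hσ
  refine ⟨k, coordMap σ fun i => ε (σ i), inner_coordMap _ _, ?_, ?_⟩
  · rw [baseQuad, ← signedPoint_eq_toPoint (k := k) (σ := σ) (δ := fun i => ε (σ i)) fun i => rfl,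
      ← signedPoint_eq_toPoint (k := k) (σ := 1) (δ := fun _ => true) fun i => rfl,
      coordMap_signedPoint]
    simp
  · refine Finset.eq_of_subset_of_card_le (fun y hy => ?_) ?_
    · obtain ⟨z, hz, rfl⟩ := Finset.mem_image.1 hy
      obtain ⟨k', τ, δ, hτ, rfl⟩ := mem_cell120Config.1 hz
      rw [coordMap_signedPoint]
      refine mem_cell120Config.2 ⟨k', _, _, hτ.imp_right fun h => ?_, rfl⟩
      simp [h, hs]
    · rw [Finset.card_image_of_injective _ (injective_of_inner_eq (inner_coordMap _ _))]

theorem onSphere_cell120Config : onSphere cell120Config := by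
  intro x hx
  obtain ⟨k, A, hA, rfl, -⟩ := exists_symmetry hx
  have h : ∀ k, (baseQuad k).dot (baseQuad k) = ⟨32, 0⟩ := by decide
  rw [norm_eq_sqrt_real_inner, hA, Quad.inner_toPoint, h, embR_mk]
  norm_num

theorem sum_cell120Config {x : EuclideanSpace ℝ (Fin 4)} (hx : x ∈ cell120Config) (F : ℝ → ℝ) :
    ∑ y ∈ cell120Config, F (inner ℝ x y) =
      (ipDistr.map fun s => s.2 * F (embR s.1 / 8)).sum := by
  obtain ⟨k, A, hA, rfl, hD⟩ := exists_symmetry hx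
  rw [← hD, Finset.sum_image fun _ _ _ _ h => injective_of_inner_eq hA h]
  simp only [hA]
  rw [cell120Config_eq_image, Finset.sum_image fun _ _ _ _ h => Quad.toPoint_injective h,
    List.sum_toFinset _ cellList_nodup]
  have h := ((map_dot_cellList_perm k).map fun s => F (embR s / 32)).sum_eq
  rw [List.map_map] at h
  simp only [Quad.inner_toPoint]
  refine Eq.trans h.symm ?_
  rw [List.map_flatMap, List.flatMap_def, List.sum_flatten, List.map_map]
  congr 1
  refine List.map_congr_left fun s _ => ?_
  simp only [Function.comp_apply, List.map_replicate, List.sum_replicate, nsmul_eq_mul, map_mul]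
  rw [embR_mk]
  congr 2
  push_cast
  ring

theorem inner_cell120Config {x y : EuclideanSpace ℝ (Fin 4)} (hx : x ∈ cell120Config)
    (hy : y ∈ cell120Config) : ∃ s ∈ ipDistr, inner ℝ x y = embR s.1 / 8 := by
  obtain ⟨k, A, hA, rfl, hD⟩ := exists_symmetry hx
  rw [← hD] at hy
  obtain ⟨z, hz, rfl⟩ := Finset.mem_image.1 hy
  obtain ⟨q, hq, rfl⟩ := mem_cell120Config_iff_toPoint.1 hz
  have h := (map_dot_cellList_perm k).mem_iff.2 (List.mem_map_of_mem hq)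
  obtain ⟨s, hs, h⟩ := List.mem_flatMap.1 h
  refine ⟨s, hs, ?_⟩
  rw [hA, Quad.inner_toPoint, List.eq_of_mem_replicate h, map_mul, embR_mk]
  push_cast
  ring

end CellVertices

/-! ### Chebyshev polynomials at the inner products of the 120-cell -/

section Chebyshev

/-- Consecutive terms of the Chebyshev-type sequence `v (n + 2) = s * v (n + 1) - c * v n`. -/
def chebPair {R : Type*} [CommRing R] (c s : R) : ℕ → R × R
  | 0 => (1, s)
  | n + 1 => ((chebPair c s n).2, s * (chebPair c s n).2 - c * (chebPair c s n).1)

theorem map_chebPair {R S : Type*} [CommRing R] [CommRing S] (f : R →+* S) (c s : R) (n : ℕ) :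
    chebPair (f c) (f s) n = ((f (chebPair c s n).1), f (chebPair c s n).2) := by
  induction n with
  | zero => simp [chebPair]
  | succ n ih => simp [chebPair, ih]

theorem chebPair_eq_eval (t : ℝ) (n : ℕ) : chebPair 16 (8 * t) n =
    (4 ^ n * (Polynomial.Chebyshev.U ℝ n).eval t,
      4 ^ (n + 1) * (Polynomial.Chebyshev.U ℝ (n + 1)).eval t) := by
  induction n with
  | zero => simp [chebPair]; ring
  | succ n ih =>
    have h := Polynomial.Chebyshev.U_add_two ℝ n
    rw [add_assoc, Nat.cast_succ, add_assoc, show (1 : ℤ) + 1 = 2 by norm_num, h]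
    simp [chebPair, ih]
    ring

theorem embR_int (a : ℤ) : embR ⟨a, 0⟩ = a := by simp [embR_mk]

theorem four_pow_mul_eval_chebyshevU (s : ℤ√5) (n : ℕ) :
    4 ^ n * (Polynomial.Chebyshev.U ℝ n).eval (embR s / 8) =
      embR (chebPair ⟨16, 0⟩ s n).1 := by
  have h := map_chebPair embR ⟨16, 0⟩ s n
  rw [embR_mk, show embR s = 8 * (embR s / 8) by ring] at h
  push_cast at h
  rw [zero_mul, add_zero, chebPair_eq_eval] at h
  exact congrArg Prod.fst h

theorem embR_nonpos {z : ℤ√5} (h1 : 10000000 * z.re + 22360679 * z.im ≤ 0)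
    (h2 : 10000000 * z.re + 22360680 * z.im ≤ 0) : embR z ≤ 0 := by
  have h3 : (22360679 : ℝ) ≤ 10000000 * √5 := by
    have : (2.2360679 : ℝ) ≤ √5 := Real.le_sqrt_of_sq_le (by norm_num)
    linarith
  have h4 : 10000000 * √5 ≤ (22360680 : ℝ) := by
    have : √5 ≤ (2.236068 : ℝ) := Real.sqrt_le_iff.2 (by norm_num)
    linarith
  have h1' : (10000000 * z.re + 22360679 * z.im : ℝ) ≤ 0 := by exact_mod_cast h1
  have h2' : (10000000 * z.re + 22360680 * z.im : ℝ) ≤ 0 := by exact_mod_cast h2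
  change embR ⟨z.re, z.im⟩ ≤ 0
  rw [embR_mk]
  rcases le_total (z.im : ℝ) 0 with h | h <;> nlinarith

theorem sum_chebyshevU_cell120Config {x : EuclideanSpace ℝ (Fin 4)} (hx : x ∈ cell120Config)
    (j : Fin 29) :
    ∑ y ∈ cell120Config, (Polynomial.Chebyshev.U ℝ (m120 j)).eval (inner ℝ x y) = 0 := by
  have h : ∀ j, (ipDistr.map fun s => (⟨s.2, 0⟩ : ℤ√5) * (chebPair ⟨16, 0⟩ s.1 (m120 j)).1).sum =
      ⟨0, 0⟩ := by decide +kernel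
  have h' := congrArg embR (h j)
  rw [map_list_sum, List.map_map] at h'
  have h4 : (4 : ℝ) ^ m120 j ≠ 0 := by positivity
  rw [sum_cell120Config hx fun t => (Polynomial.Chebyshev.U ℝ (m120 j)).eval t,
    ← mul_right_inj' h4, mul_zero, ← List.sum_map_mul_left]
  refine Eq.trans (congrArg List.sum (List.map_congr_left fun s _ => ?_)) 
    (h'.trans (by simp [embR_int]))
  rw [mul_left_comm, four_pow_mul_eval_chebyshevU, Function.comp_apply, map_mul, embR_int]
  simp

/-- Eight times the roots of `q120`. -/
def ipRoots : List (ℤ√5) :=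
  [⟨0, 0⟩, ⟨-8, 0⟩, ⟨-2, 0⟩, ⟨2, 0⟩, ⟨-6, 0⟩, ⟨6, 0⟩, ⟨-4, 0⟩, ⟨4, 0⟩, ⟨0, 2⟩, ⟨0, -2⟩,
    ⟨-2, 2⟩, ⟨-2, -2⟩, ⟨2, 2⟩, ⟨2, -2⟩, ⟨-1, 1⟩, ⟨-1, -1⟩, ⟨1, 1⟩, ⟨1, -1⟩, ⟨-1, 3⟩, ⟨-1, -3⟩,
    ⟨1, 3⟩, ⟨1, -3⟩, ⟨-3, 1⟩, ⟨-3, -1⟩, ⟨3, 1⟩, ⟨3, -1⟩, ⟨-5, 1⟩, ⟨-5, -1⟩, ⟨5, 1⟩, ⟨5, -1⟩]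

theorem eq_or_eq_iff_quadratic {a r s t : ℝ} (ha : a ≠ 0) {p : ℝ}
    (h : p = a * (t - r) * (t - s)) : p = 0 ↔ t = r ∨ t = s := by
  simp [h, ha, sub_eq_zero]

theorem q120_eq_zero_iff {t : ℝ} : q120 t = 0 ↔ ∃ s ∈ ipRoots, t = embR s / 8 := by
  have h5 := sqrt_five_sq
  have l1 : t + 1 = 0 ↔ t = -8 / 8 := by constructor <;> intro h <;> linarith
  have l2 : 4 * t + 1 = 0 ↔ t = -2 / 8 := by constructor <;> intro h <;> linarith
  have l3 : 4 * t - 1 = 0 ↔ t = 2 / 8 := by constructor <;> intro h <;> linarith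
  have l4 : 4 * t + 3 = 0 ↔ t = -6 / 8 := by constructor <;> intro h <;> linarith
  have l5 : 4 * t - 3 = 0 ↔ t = 6 / 8 := by constructor <;> intro h <;> linarith
  have l6 : 2 * t + 1 = 0 ↔ t = -4 / 8 := by constructor <;> intro h <;> linarith
  have l7 : 2 * t - 1 = 0 ↔ t = 4 / 8 := by constructor <;> intro h <;> linarith
  have q0 : 16 * t ^ 2 - 5 = 0 ↔ t = 2 * √5 / 8 ∨ t = -(2 * √5) / 8 :=
    eq_or_eq_iff_quadratic (a := 16) (by norm_num) (by linear_combination h5)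
  have q1 : 4 * t ^ 2 + 2 * t - 1 = 0 ↔ t = (-2 + 2 * √5) / 8 ∨ t = (-2 + -(2 * √5)) / 8 :=
    eq_or_eq_iff_quadratic (a := 4) (by norm_num) (by linear_combination h5 / 4)
  have q2 : 4 * t ^ 2 - 2 * t - 1 = 0 ↔ t = (2 + 2 * √5) / 8 ∨ t = (2 + -(2 * √5)) / 8 :=
    eq_or_eq_iff_quadratic (a := 4) (by norm_num) (by linear_combination h5 / 4)
  have q3 : 16 * t ^ 2 + 4 * t - 1 = 0 ↔ t = (-1 + √5) / 8 ∨ t = (-1 + -√5) / 8 :=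
    eq_or_eq_iff_quadratic (a := 16) (by norm_num) (by linear_combination h5 / 4)
  have q4 : 16 * t ^ 2 - 4 * t - 1 = 0 ↔ t = (1 + √5) / 8 ∨ t = (1 + -√5) / 8 :=
    eq_or_eq_iff_quadratic (a := 16) (by norm_num) (by linear_combination h5 / 4)
  have q5 : 16 * t ^ 2 + 4 * t - 11 = 0 ↔ t = (-1 + 3 * √5) / 8 ∨ t = (-1 + -(3 * √5)) / 8 :=
    eq_or_eq_iff_quadratic (a := 16) (by norm_num) (by linear_combination 9 * h5 / 4)
  have q6 : 16 * t ^ 2 - 4 * t - 11 = 0 ↔ t = (1 + 3 * √5) / 8 ∨ t = (1 + -(3 * √5)) / 8 :=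
    eq_or_eq_iff_quadratic (a := 16) (by norm_num) (by linear_combination 9 * h5 / 4)
  have q7 : 16 * t ^ 2 + 12 * t + 1 = 0 ↔ t = (-3 + √5) / 8 ∨ t = (-3 + -√5) / 8 :=
    eq_or_eq_iff_quadratic (a := 16) (by norm_num) (by linear_combination h5 / 4)
  have q8 : 16 * t ^ 2 - 12 * t + 1 = 0 ↔ t = (3 + √5) / 8 ∨ t = (3 + -√5) / 8 :=
    eq_or_eq_iff_quadratic (a := 16) (by norm_num) (by linear_combination h5 / 4)
  have q9 : 16 * t ^ 2 + 20 * t + 5 = 0 ↔ t = (-5 + √5) / 8 ∨ t = (-5 + -√5) / 8 :=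
    eq_or_eq_iff_quadratic (a := 16) (by norm_num) (by linear_combination h5 / 4)
  have q10 : 16 * t ^ 2 - 20 * t + 5 = 0 ↔ t = (5 + √5) / 8 ∨ t = (5 + -√5) / 8 :=
    eq_or_eq_iff_quadratic (a := 16) (by norm_num) (by linear_combination h5 / 4)
  have hp : (2 : ℝ) ^ 50 ≠ 0 := by positivity
  simp only [q120, div_eq_zero_iff, hp, or_false, mul_eq_zero, l1, l2, l3, l4, l5, l6, l7, q0, q1,
    q2, q3, q4, q5, q6, q7, q8, q9, q10, or_assoc]
  simp [ipRoots, embR_mk]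

theorem q120_inner_cell120Config {x y : EuclideanSpace ℝ (Fin 4)} (hx : x ∈ cell120Config)
    (hy : y ∈ cell120Config) (hxy : x ≠ y) : q120 (inner ℝ x y) = 0 := by
  obtain ⟨s, hs, h⟩ := inner_cell120Config hx hy
  have h' : ∀ s ∈ ipDistr, s.1 = ⟨8, 0⟩ ∨ s.1 ∈ ipRoots := by decide
  rcases h' s hs with h' | h'
  · refine absurd ?_ hxy
    rw [h', embR_mk] at h
    refine (inner_eq_one_iff_of_norm_eq_one (𝕜 := ℝ) (onSphere_cell120Config x hx)
      (onSphere_cell120Config y hy)).1 (by rw [h]; norm_num)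
  · exact q120_eq_zero_iff.2 ⟨s.1, h', h⟩

end Chebyshev

/-! ### Energy -/

section Energy

/-- The polynomial part of the potential. -/
noncomputable def polyPart (t : ℝ) : ℝ :=
  ∑ i ∈ Finset.Icc 1 17, c120 i * gegenP i t + ∑ j : Fin 29, gegenP (m120 j) t / 10 ^ 6

/-- The sum of a Chebyshev polynomial over the inner products of a configuration. -/
noncomputable def chebMoment (C : Finset (EuclideanSpace ℝ (Fin 4))) (n : ℕ) : ℝ :=
  ∑ x ∈ C, ∑ y ∈ C, (Polynomial.Chebyshev.U ℝ n).eval (inner ℝ x y)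

/-- The contribution of the rational part of the potential to the energy. -/
noncomputable def rationalEnergy (C : Finset (EuclideanSpace ℝ (Fin 4))) : ℝ :=
  ∑ x ∈ C, ∑ y ∈ C,
    if x = y then 0 else 10 ^ 5 * q120 (inner ℝ x y) ^ 2 / (1 - inner ℝ x y)

theorem sum_gegenP (C : Finset (EuclideanSpace ℝ (Fin 4))) (n : ℕ) :
    ∑ x ∈ C, ∑ y ∈ C, gegenP n (inner ℝ x y) = chebMoment C n / (n + 1) := by
  simp [chebMoment, gegenP, Finset.sum_div]

theorem sum_polyPart (C : Finset (EuclideanSpace ℝ (Fin 4))) :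
    ∑ x ∈ C, ∑ y ∈ C, polyPart (inner ℝ x y) =
      ∑ i ∈ Finset.Icc 1 17, c120 i * (chebMoment C i / (i + 1)) +
        ∑ j, chebMoment C (m120 j) / (m120 j + 1) / 10 ^ 6 := by
  have hcomm {ι : Type} (s : Finset ι) (f : ι → ℝ → ℝ) :
      ∑ x ∈ C, ∑ y ∈ C, ∑ i ∈ s, f i (inner ℝ x y) =
        ∑ i ∈ s, ∑ x ∈ C, ∑ y ∈ C, f i (inner ℝ x y) :=
    (Finset.sum_congr rfl fun x _ => Finset.sum_comm).trans Finset.sum_comm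
  simp_rw [← sum_gegenP, polyPart, Finset.sum_add_distrib, Finset.mul_sum, Finset.sum_div]
  rw [hcomm (Finset.Icc 1 17) fun i t => c120 i * gegenP i t,
    hcomm Finset.univ fun j t => gegenP (m120 j) t / 10 ^ 6]

theorem energy_eq {C : Finset (EuclideanSpace ℝ (Fin 4))} (hC : onSphere C) :
    energy V120 C = (∑ x ∈ C, ∑ y ∈ C, polyPart (inner ℝ x y) - C.card * polyPart 1 +
      rationalEnergy C) / 2 := by
  have h : ∀ x ∈ C, (∑ y ∈ C, if x = y then 0 else V120 (dist x y)) =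
      ∑ y ∈ C, polyPart (inner ℝ x y) - polyPart 1 +
        ∑ y ∈ C, if x = y then 0 else 10 ^ 5 * q120 (inner ℝ x y) ^ 2 / (1 - inner ℝ x y) := by
    intro x hx
    have h1 : polyPart 1 = ∑ y ∈ C, if x = y then polyPart (inner ℝ x y) else 0 := by
      rw [Finset.sum_ite_eq, if_pos hx, real_inner_self_eq_norm_sq, hC x hx, one_pow]
    rw [h1, ← Finset.sum_sub_distrib, ← Finset.sum_add_distrib]
    refine Finset.sum_congr rfl fun y hy => ?_
    split_ifs
    · ring
    · have h2 : 1 - dist x y ^ 2 / 2 = inner ℝ x y := by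
        rw [dist_eq_norm, norm_sub_sq_real, hC x hx, hC y hy]; ring
      rw [V120, h2, W120, polyPart]
      ring
  rw [energy, Finset.sum_congr rfl h, Finset.sum_add_distrib, Finset.sum_sub_distrib,
    Finset.sum_const, nsmul_eq_mul, rationalEnergy]
  ring

theorem c120_nonneg (i : ℕ) : 0 ≤ c120 i := by
  unfold c120; split <;> norm_num

theorem c120_eq_zero_or (i : ℕ) : c120 i = 0 ∨ ∃ j, m120 j = i := by
  by_cases h : i ∈ [1, 2, 3, 4, 5, 6, 7, 8, 9, 10, 11, 13, 14, 15, 16, 17]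
  · right
    revert i
    decide
  · left
    unfold c120; split <;> simp at h ⊢

theorem chebMoment_nonneg {C : Finset (EuclideanSpace ℝ (Fin 4))} (hC : onSphere C) (n : ℕ) :
    0 ≤ chebMoment C n := sum_sum_chebyshevU_nonneg hC n

theorem rationalEnergy_term_nonneg {x y : EuclideanSpace ℝ (Fin 4)} (hx : ‖x‖ = 1)
    (hy : ‖y‖ = 1) :
    0 ≤ if x = y then 0 else 10 ^ 5 * q120 (inner ℝ x y) ^ 2 / (1 - inner ℝ x y) := by
  have h : inner ℝ x y ≤ 1 := by simpa [hx, hy] using real_inner_le_norm x y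
  split_ifs
  · rfl
  · have := sub_nonneg.2 h
    positivity

theorem rationalEnergy_nonneg {C : Finset (EuclideanSpace ℝ (Fin 4))} (hC : onSphere C) :
    0 ≤ rationalEnergy C :=
  Finset.sum_nonneg fun x hx => Finset.sum_nonneg fun y hy =>
    rationalEnergy_term_nonneg (hC x hx) (hC y hy)

theorem q120_inner_eq_zero {C : Finset (EuclideanSpace ℝ (Fin 4))} (hC : onSphere C)
    (h : rationalEnergy C = 0) {x y : EuclideanSpace ℝ (Fin 4)} (hx : x ∈ C) (hy : y ∈ C)
    (hxy : x ≠ y) : q120 (inner ℝ x y) = 0 := by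
  have h0 (x) (hx : x ∈ C) (y) (hy : y ∈ C) := rationalEnergy_term_nonneg (hC x hx) (hC y hy)
  have h1 := (Finset.sum_eq_zero_iff_of_nonneg (h0 x hx)).1
    ((Finset.sum_eq_zero_iff_of_nonneg fun x hx => Finset.sum_nonneg (h0 x hx)).1 h x hx) y hy
  rw [if_neg hxy, div_eq_zero_iff, mul_eq_zero] at h1
  rcases h1 with (h1 | h1) | h1
  · norm_num at h1
  · exact pow_eq_zero_iff (two_ne_zero) |>.1 h1
  · exact absurd ((inner_eq_one_iff_of_norm_eq_one (𝕜 := ℝ) (hC x hx) (hC y hy)).1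
      (sub_eq_zero.1 h1).symm) hxy

theorem polyPart_terms_nonneg {C : Finset (EuclideanSpace ℝ (Fin 4))} (hC : onSphere C) :
    (∀ i, 0 ≤ c120 i * (chebMoment C i / (i + 1))) ∧
      ∀ j, 0 ≤ chebMoment C (m120 j) / (m120 j + 1) / 10 ^ 6 := by
  constructor
  · intro i
    have := c120_nonneg i
    have := chebMoment_nonneg hC i
    positivity
  · intro j
    have := chebMoment_nonneg hC (m120 j)
    positivity

theorem sum_polyPart_nonneg {C : Finset (EuclideanSpace ℝ (Fin 4))} (hC : onSphere C) :
    0 ≤ ∑ x ∈ C, ∑ y ∈ C, polyPart (inner ℝ x y) := by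
  rw [sum_polyPart]
  exact add_nonneg (Finset.sum_nonneg fun i _ => (polyPart_terms_nonneg hC).1 i)
    (Finset.sum_nonneg fun j _ => (polyPart_terms_nonneg hC).2 j)

theorem chebMoment_eq_zero {C : Finset (EuclideanSpace ℝ (Fin 4))} (hC : onSphere C)
    (h : ∑ x ∈ C, ∑ y ∈ C, polyPart (inner ℝ x y) = 0) (j : Fin 29) :
    chebMoment C (m120 j) = 0 := by
  obtain ⟨h1, h2⟩ := polyPart_terms_nonneg hC
  rw [sum_polyPart] at h
  have h3 := (add_eq_zero_iff_of_nonneg (Finset.sum_nonneg fun i _ => h1 i)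
    (Finset.sum_nonneg fun j _ => h2 j)).1 h
  have h4 := (Finset.sum_eq_zero_iff_of_nonneg fun j _ => h2 j).1 h3.2 j (Finset.mem_univ j)
  have h5 : (m120 j + 1 : ℝ) ≠ 0 := by positivity
  simpa [h5] using h4

theorem energy_cell120Config : energy V120 cell120Config = -300 * polyPart 1 := by
  have hm (j : Fin 29) : chebMoment cell120Config (m120 j) = 0 :=
    Finset.sum_eq_zero fun x hx => sum_chebyshevU_cell120Config hx j
  have h1 : ∑ x ∈ cell120Config, ∑ y ∈ cell120Config, polyPart (inner ℝ x y) = 0 := by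
    rw [sum_polyPart, Finset.sum_eq_zero, Finset.sum_eq_zero, add_zero]
    · simp [hm]
    · intro i _
      rcases c120_eq_zero_or i with h | ⟨j, rfl⟩
      · simp [h]
      · simp [hm]
  have h2 : rationalEnergy cell120Config = 0 := by
    refine Finset.sum_eq_zero fun x hx => Finset.sum_eq_zero fun y hy => ?_
    split_ifs with h
    · rfl
    · simp [q120_inner_cell120Config hx hy h]
  rw [energy_eq onSphere_cell120Config, h1, h2, card_cell120Config]
  push_cast
  ring

theorem energy_cell120Config_le {C : Finset (EuclideanSpace ℝ (Fin 4))} (hcard : C.card = 600)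
    (hC : onSphere C) : energy V120 cell120Config ≤ energy V120 C := by
  rw [energy_cell120Config, energy_eq hC, hcard]
  have h1 := sum_polyPart_nonneg hC
  have h2 := rationalEnergy_nonneg hC
  push_cast
  linarith

/-- The properties shared by all the configurations of minimal energy. -/
structure IsTight (C : Finset (EuclideanSpace ℝ (Fin 4))) : Prop where
  card_eq : C.card = 600
  norm_eq : ∀ x ∈ C, ‖x‖ = 1
  inner_eq : ∀ x ∈ C, ∀ y ∈ C, x ≠ y → ∃ s ∈ ipRoots, inner ℝ x y = embR s / 8
  moment_eq : ∀ j : Fin 29, ∀ x ∈ C,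
    ∑ y ∈ C, (Polynomial.Chebyshev.U ℝ (m120 j)).eval (inner ℝ x y) = 0

theorem isTight_of_energy_eq {C : Finset (EuclideanSpace ℝ (Fin 4))} (hcard : C.card = 600)
    (hC : onSphere C) (h : energy V120 C = energy V120 cell120Config) : IsTight C := by
  rw [energy_cell120Config, energy_eq hC, hcard] at h
  have h1 := sum_polyPart_nonneg hC
  have h2 := rationalEnergy_nonneg hC
  push_cast at h
  have h3 : ∑ x ∈ C, ∑ y ∈ C, polyPart (inner ℝ x y) = 0 := by linarith
  have h4 : rationalEnergy C = 0 := by linarith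
  exact
    { card_eq := hcard
      norm_eq := hC
      inner_eq := fun x hx y hy hxy => q120_eq_zero_iff.1 (q120_inner_eq_zero hC h4 hx hy hxy)
      moment_eq := fun j x hx =>
        sum_chebyshevU_eq_zero hC (chebMoment_eq_zero hC h3 j) (hC x hx) }

theorem isTight_cell120Config : IsTight cell120Config :=
  isTight_of_energy_eq card_cell120Config onSphere_cell120Config rfl

end Energy

/-! ### Nearest neighbours -/

section Neighbours

/-- The coefficients of an auxiliary polynomial in the basis of Chebyshev polynomials. -/
def nbrCoeffs : List (Fin 29 × ℤ) :=
  [(14, 151), (0, 227), (15, 301), (1, 351), (16, 374), (2, 364), (17, 331), (3, 275), (18, 212),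
    (4, 138), (19, 79), (20, -48), (5, -105), (21, -121), (6, -125), (22, -100), (7, -66),
    (23, -35), (8, 11)]

/-- The values of the auxiliary polynomial, up to scaling. -/
def nbrPoly (s : ℤ√5) : ℤ√5 :=
  ⟨67 * 4 ^ 22, 0⟩ + (nbrCoeffs.map fun c =>
    (⟨c.2 * 4 ^ (22 - m120 c.1), 0⟩ : ℤ√5) * (chebPair ⟨16, 0⟩ s (m120 c.1)).1).sum

theorem embR_nbrPoly (s : ℤ√5) : embR (nbrPoly s) = 4 ^ 22 * (67 + (nbrCoeffs.map fun c =>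
    c.2 * (Polynomial.Chebyshev.U ℝ (m120 c.1)).eval (embR s / 8)).sum) := by
  have h : ∀ c ∈ nbrCoeffs, m120 c.1 ≤ 22 := by decide
  rw [nbrPoly, map_add, map_list_sum, List.map_map, mul_add, ← List.sum_map_mul_left, embR_mk]
  congr 1
  · push_cast; ring
  · refine congrArg List.sum (List.map_congr_left fun c hc => ?_)
    rw [Function.comp_apply, map_mul, ← four_pow_mul_eval_chebyshevU, embR_mk,
      ← Nat.sub_add_cancel (h c hc), pow_add]
    simp
    ring

/-- The cosine of the edge length of the 120-cell. -/
noncomputable def edgeCos : ℝ := (1 + 3 * √5) / 8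

theorem nbrPoly_nonpos : ∀ s ∈ ipRoots, s ≠ ⟨1, 3⟩ → embR (nbrPoly s) ≤ 0 := by
  have h : ∀ s ∈ ipRoots, s ≠ ⟨1, 3⟩ → 10000000 * (nbrPoly s).re + 22360679 * (nbrPoly s).im ≤ 0 ∧
      10000000 * (nbrPoly s).re + 22360680 * (nbrPoly s).im ≤ 0 := by decide +kernel
  exact fun s hs hs' => embR_nonpos (h s hs hs').1 (h s hs hs').2

theorem nbrPoly_edge : embR (nbrPoly ⟨8, 0⟩) + 3 * embR (nbrPoly ⟨1, 3⟩) < 67 * 4 ^ 22 * 600 ∧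
    0 ≤ embR (nbrPoly ⟨1, 3⟩) := by
  have h1 : 10000000 * (nbrPoly ⟨8, 0⟩ + ⟨3, 0⟩ * nbrPoly ⟨1, 3⟩ - ⟨67 * 4 ^ 22 * 600 - 1, 0⟩).re +
      22360679 * (nbrPoly ⟨8, 0⟩ + ⟨3, 0⟩ * nbrPoly ⟨1, 3⟩ - ⟨67 * 4 ^ 22 * 600 - 1, 0⟩).im ≤ 0 ∧
      10000000 * (nbrPoly ⟨8, 0⟩ + ⟨3, 0⟩ * nbrPoly ⟨1, 3⟩ - ⟨67 * 4 ^ 22 * 600 - 1, 0⟩).re +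
      22360680 * (nbrPoly ⟨8, 0⟩ + ⟨3, 0⟩ * nbrPoly ⟨1, 3⟩ - ⟨67 * 4 ^ 22 * 600 - 1, 0⟩).im ≤ 0 := by
    decide +kernel
  have h2 : 10000000 * (-nbrPoly ⟨1, 3⟩).re + 22360679 * (-nbrPoly ⟨1, 3⟩).im ≤ 0 ∧
      10000000 * (-nbrPoly ⟨1, 3⟩).re + 22360680 * (-nbrPoly ⟨1, 3⟩).im ≤ 0 := by
    decide +kernel
  have h1' := embR_nonpos h1.1 h1.2
  have h2' := embR_nonpos h2.1 h2.2
  rw [map_sub, map_add, map_mul, embR_int 3, embR_int (67 * 4 ^ 22 * 600 - 1)] at h1'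
  rw [map_neg] at h2'
  push_cast at h1'
  exact ⟨by linarith, by linarith⟩

/-- The nearest neighbours of a point. -/
noncomputable def nbrs (C : Finset (EuclideanSpace ℝ (Fin 4))) (x : EuclideanSpace ℝ (Fin 4)) :
    Finset (EuclideanSpace ℝ (Fin 4)) :=
  C.filter fun y => inner ℝ x y = edgeCos

theorem embR_edge : embR ⟨1, 3⟩ / 8 = edgeCos := by
  rw [embR_mk, edgeCos]; push_cast; ring

theorem IsTight.four_le_card_nbrs {C : Finset (EuclideanSpace ℝ (Fin 4))} (hC : IsTight C)
    {x : EuclideanSpace ℝ (Fin 4)} (hx : x ∈ C) : 4 ≤ (nbrs C x).card := by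
  set F : ℝ → ℝ := fun t => 4 ^ 22 * (67 + (nbrCoeffs.map fun c =>
    c.2 * (Polynomial.Chebyshev.U ℝ (m120 c.1)).eval t).sum) with hF
  have hF' (s : ℤ√5) : F (embR s / 8) = embR (nbrPoly s) := (embR_nbrPoly s).symm
  have hsum : ∑ y ∈ C, F (inner ℝ x y) = 67 * 4 ^ 22 * 600 := by
    have h : ∑ y ∈ C, (nbrCoeffs.map fun c =>
        c.2 * (Polynomial.Chebyshev.U ℝ (m120 c.1)).eval (inner ℝ x y)).sum = 0 := by
      have hl (l : List (Fin 29 × ℤ)) : ∑ y ∈ C, (l.map fun c =>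
          c.2 * (Polynomial.Chebyshev.U ℝ (m120 c.1)).eval (inner ℝ x y)).sum = 0 := by
        induction l with
        | nil => simp
        | cons c l ih => simp [Finset.sum_add_distrib, ih, ← Finset.mul_sum, hC.moment_eq c.1 x hx]
      exact hl _
    rw [hF, ← Finset.mul_sum, Finset.sum_add_distrib, h, Finset.sum_const, hC.card_eq]
    norm_num
  have h1 : F (inner ℝ x x) = embR (nbrPoly ⟨8, 0⟩) := by
    rw [← hF', embR_mk, real_inner_self_eq_norm_sq, hC.norm_eq x hx]
    norm_num
  have h2 : ∑ y ∈ C.erase x, F (inner ℝ x y) ≤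
      ∑ y ∈ C.erase x, if inner ℝ x y = edgeCos then embR (nbrPoly ⟨1, 3⟩) else 0 := by
    refine Finset.sum_le_sum fun y hy => ?_
    obtain ⟨hyx, hy⟩ := Finset.mem_erase.1 hy
    obtain ⟨s, hs, h⟩ := hC.inner_eq x hx y hy hyx.symm
    split_ifs with he
    · rw [he, ← embR_edge, hF']
    · rw [h, hF']
      refine nbrPoly_nonpos s hs fun h' => he ?_
      rw [h, h', embR_edge]
  rw [← Finset.sum_filter, Finset.sum_const, nsmul_eq_mul] at h2
  have h3 : ((C.erase x).filter fun y => inner ℝ x y = edgeCos).card ≤ (nbrs C x).card :=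
    Finset.card_le_card (Finset.filter_subset_filter _ (Finset.erase_subset _ _))
  have h4 := Finset.add_sum_erase C (fun y => F (inner ℝ x y)) hx
  by_contra! h5
  have h6 : (((C.erase x).filter fun y => inner ℝ x y = edgeCos).card : ℝ) ≤ 3 := by
    exact_mod_cast (by omega : ((C.erase x).filter fun y => inner ℝ x y = edgeCos).card ≤ 3)
  have h7 := mul_le_mul_of_nonneg_right h6 nbrPoly_edge.2
  have h8 := nbrPoly_edge.1
  linarith

end Neighbours

/-! ### The arrangement of the neighbours of a point -/

section Local

/-- Four-dimensional Euclidean space. -/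
abbrev Space : Type := EuclideanSpace ℝ (Fin 4)

/-- The second largest inner product between distinct vertices of the 120-cell. -/
noncomputable def secondCos : ℝ := (5 + √5) / 8

theorem sqrt_five_bounds : 2.236 < √5 ∧ √5 < 2.2361 :=
  ⟨Real.lt_sqrt_of_sq_lt (by norm_num), (Real.sqrt_lt' (by norm_num)).2 (by norm_num)⟩

theorem embR_div_eight_cases {s : ℤ√5} (hs : s ∈ ipRoots) :
    embR s / 8 = edgeCos ∨ embR s / 8 = secondCos ∨ embR s / 8 ≤ 0.82 := by
  have h : ∀ s ∈ ipRoots, s = ⟨1, 3⟩ ∨ s = ⟨5, 1⟩ ∨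
      10000000 * (50 * s.re - 328) + 22360679 * (50 * s.im) ≤ 0 ∧
      10000000 * (50 * s.re - 328) + 22360680 * (50 * s.im) ≤ 0 := by decide
  rcases h s hs with rfl | rfl | ⟨h1, h2⟩
  · exact Or.inl embR_edge
  · exact Or.inr (Or.inl (by rw [embR_mk, secondCos]; push_cast; ring))
  · have h3 := embR_nonpos (z := ⟨50 * s.re - 328, 50 * s.im⟩) h1 h2
    rw [embR_mk] at h3
    push_cast at h3
    rw [show embR s = s.re + s.im * √5 from embR_mk s.re s.im]
    exact Or.inr (Or.inr (by linarith))

theorem exists_linear_dependence (f : Fin 5 → Space) :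
    ∃ c : Fin 5 → ℝ, ∑ i, c i • f i = 0 ∧ ∃ i, c i ≠ 0 := by
  refine Fintype.not_linearIndependent_iff.1 fun h => ?_
  have := h.fintype_card_le_finrank
  simp at this

/-- The determinant of a symmetric `4 × 4` matrix with constant diagonal. -/
def symmDet {R : Type*} [CommRing R] (d p q r s t u : R) : R :=
  d * d * (d * d - (p * p + q * q + r * r + s * s + t * t + u * u)) +
    d * (p * q * s + p * r * t + q * r * u + s * t * u +
      (p * q * s + p * r * t + q * r * u + s * t * u)) +
    (p * u) * (p * u) + (q * t) * (q * t) + (r * s) * (r * s) -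
    (p * u * (q * t) + p * u * (r * s) + q * t * (r * s)) -
    (p * u * (q * t) + p * u * (r * s) + q * t * (r * s))

theorem map_symmDet {R S : Type*} [CommRing R] [CommRing S] (f : R →+* S) (d p q r s t u : R) :
    f (symmDet d p q r s t u) = symmDet (f d) (f p) (f q) (f r) (f s) (f t) (f u) := by
  simp [symmDet]

theorem symmDet_eq_zero {d p q r s t u : ℝ} {c : Fin 4 → ℝ} (hc : ∃ i, c i ≠ 0)
    (h0 : d * c 0 + p * c 1 + q * c 2 + r * c 3 = 0)
    (h1 : p * c 0 + d * c 1 + s * c 2 + t * c 3 = 0)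
    (h2 : q * c 0 + s * c 1 + d * c 2 + u * c 3 = 0)
    (h3 : r * c 0 + t * c 1 + u * c 2 + d * c 3 = 0) : symmDet d p q r s t u = 0 := by
  have h : Matrix.det !![d, p, q, r; p, d, s, t; q, s, d, u; r, t, u, d] = 0 := by
    refine Matrix.exists_mulVec_eq_zero_iff.1 ⟨c, fun hc' => ?_, ?_⟩
    · obtain ⟨i, hi⟩ := hc
      exact hi (congrFun hc' i)
    · ext i
      fin_cases i <;> simp [Matrix.mulVec, dotProduct, Fin.sum_univ_four, h0, h1, h2, h3]
  rw [← h]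
  simp [Matrix.det_succ_row_zero, Fin.sum_univ_succ, symmDet, Fin.succAbove]
  ring

/-- The cosine of one of the two angles between neighbours. -/
noncomputable def nbrCos (e : Bool) : ℝ := if e then edgeCos else secondCos

/-- The entry corresponding to `nbrCos` in a rescaled Gram matrix. -/
def gramEntry (e : Bool) : ℤ√5 := if e then ⟨-3, 2⟩ else ⟨-1, 0⟩

theorem nbrCos_sub (e : Bool) :
    nbrCos e - edgeCos ^ 2 = (3 - √5) / 32 * embR (gramEntry e) := by
  have h5 := sqrt_five_sq
  cases e <;> simp [nbrCos, gramEntry, embR_mk, edgeCos, secondCos] <;> ring_nf <;> rw [h5] <;> ring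

theorem one_sub_edgeCos_sq : 1 - edgeCos ^ 2 = (3 - √5) / 32 * 3 := by
  rw [edgeCos]; linear_combination (-9 / 64) * sqrt_five_sq

theorem symmDet_gramEntry_eq_zero : ∀ q r s t u : Bool,
    symmDet ⟨3, 0⟩ ⟨-3, 2⟩ (gramEntry q) (gramEntry r) (gramEntry s) (gramEntry t) (gramEntry u) =
      ⟨0, 0⟩ →
    (q, r, s, t, u) ∈ [(false, false, true, false, true), (false, false, false, true, true),
      (true, false, false, false, true), (false, true, false, false, true),
      (true, false, false, true, false), (false, true, true, false, false)] := by
  decide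

/-- Two points are neighbours if their inner product is the largest possible one. -/
def Near (x y : Space) : Prop := inner ℝ x y = edgeCos

/-- Two points have the second largest inner product. -/
def NextNear (x y : Space) : Prop := inner ℝ x y = secondCos

theorem Near.symm {x y : Space} (h : Near x y) : Near y x := by
  rwa [Near, real_inner_comm]

theorem NextNear.symm {x y : Space} (h : NextNear x y) : NextNear y x := by
  rwa [NextNear, real_inner_comm]

theorem edgeCos_bounds : 0.9634 < edgeCos ∧ edgeCos < 0.9636 := by
  have := sqrt_five_bounds
  rw [edgeCos]; constructor <;> linarith

theorem secondCos_bounds : 0.9044 < secondCos ∧ secondCos < 0.9046 := by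
  have := sqrt_five_bounds
  rw [secondCos]; constructor <;> linarith

theorem Near.not_nextNear {x y : Space} (h : Near x y) : ¬ NextNear x y := by
  intro h'
  have := edgeCos_bounds
  have := secondCos_bounds
  rw [Near] at h
  rw [NextNear] at h'
  linarith

/-- Four points such that consecutive ones are neighbours and the other pairs have the second
largest inner product. -/
structure IsPath (p q r s : Space) : Prop where
  h₁ : Near p q
  h₂ : Near q r
  h₃ : Near r s
  h₄ : NextNear p r
  h₅ : NextNear p s
  h₆ : NextNear q s

theorem IsPath.symm {p q r s : Space} (h : IsPath p q r s) : IsPath s r q p :=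
  ⟨h.h₃.symm, h.h₂.symm, h.h₁.symm, h.h₆.symm, h.h₅.symm, h.h₄.symm⟩

variable {C : Finset Space}

theorem IsTight.near_or (hC : IsTight C) {x y : Space} (hx : x ∈ C) (hy : y ∈ C) (hxy : x ≠ y) :
    Near x y ∨ NextNear x y ∨ inner ℝ x y ≤ 0.82 := by
  obtain ⟨s, hs, h⟩ := hC.inner_eq x hx y hy hxy
  rw [Near, NextNear, h]
  exact embR_div_eight_cases hs

theorem IsTight.ne_of_near (hC : IsTight C) {x y : Space} (hx : x ∈ C) (h : Near x y) : x ≠ y := by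
  rintro rfl
  have := edgeCos_bounds
  rw [Near, real_inner_self_eq_norm_sq, hC.norm_eq x hx] at h
  linarith

theorem IsTight.ne_of_nextNear (hC : IsTight C) {x y : Space} (hx : x ∈ C) (h : NextNear x y) :
    x ≠ y := by
  rintro rfl
  have := secondCos_bounds
  rw [NextNear, real_inner_self_eq_norm_sq, hC.norm_eq x hx] at h
  linarith

theorem IsTight.near_or_nextNear (hC : IsTight C) {x n m : Space} (hx : x ∈ C) (hn : n ∈ C)
    (hm : m ∈ C) (hxn : Near x n) (hxm : Near x m) (hnm : n ≠ m) : Near n m ∨ NextNear n m := by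
  rcases hC.near_or hn hm hnm with h | h | h
  · exact Or.inl h
  · exact Or.inr h
  · exfalso
    have h1 : 0 ≤ inner ℝ (n + m - (2 * edgeCos) • x) (n + m - (2 * edgeCos) • x) :=
      real_inner_self_nonneg
    rw [Near] at hxn hxm
    have hnx : inner ℝ n x = edgeCos := (real_inner_comm _ _).trans hxn
    have hmx : inner ℝ m x = edgeCos := (real_inner_comm _ _).trans hxm
    have hmn : inner ℝ m n = inner ℝ n m := real_inner_comm _ _
    have hxx : inner ℝ x x = 1 := by rw [real_inner_self_eq_norm_sq, hC.norm_eq x hx, one_pow]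
    have hnn : inner ℝ n n = 1 := by rw [real_inner_self_eq_norm_sq, hC.norm_eq n hn, one_pow]
    have hmm : inner ℝ m m = 1 := by rw [real_inner_self_eq_norm_sq, hC.norm_eq m hm, one_pow]
    simp only [inner_sub_left, inner_sub_right, inner_add_left, inner_add_right,
      real_inner_smul_left, real_inner_smul_right, hxn, hxm, hnx, hmx, hmn, hxx, hnn, hmm] at h1
    have := edgeCos_bounds
    nlinarith

theorem symmDet_gram (hC : IsTight C) {x : Space} (hx : x ∈ C) {n : Fin 4 → Space}
    (hn : ∀ i, n i ∈ C) (hxn : ∀ i, Near x (n i)) {p q r s t u : Bool}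
    (hp : inner ℝ (n 0) (n 1) = nbrCos p) (hq : inner ℝ (n 0) (n 2) = nbrCos q)
    (hr : inner ℝ (n 0) (n 3) = nbrCos r) (hs : inner ℝ (n 1) (n 2) = nbrCos s)
    (ht : inner ℝ (n 1) (n 3) = nbrCos t) (hu : inner ℝ (n 2) (n 3) = nbrCos u) :
    symmDet ⟨3, 0⟩ (gramEntry p) (gramEntry q) (gramEntry r) (gramEntry s) (gramEntry t)
      (gramEntry u) = ⟨0, 0⟩ := by
  obtain ⟨c, hc, hc'⟩ := exists_linear_dependence (Fin.cons x n)
  rw [Fin.sum_univ_five] at hc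
  have hk : (3 - √5) / 32 ≠ 0 := by
    have := sqrt_five_bounds
    have : 0 < (3 - √5) / 32 := by linarith
    exact this.ne'
  have hsq (i : Fin 4) : inner ℝ (n i) (n i) = 1 := by
    rw [real_inner_self_eq_norm_sq, hC.norm_eq _ (hn i), one_pow]
  have hxx : inner ℝ x x = 1 := by rw [real_inner_self_eq_norm_sq, hC.norm_eq _ hx, one_pow]
  have hx0 := congrArg (fun v => inner ℝ x v) hc
  have e (i : Fin 4) := congrArg (fun v => inner ℝ (n i) v) hc
  have hnx (i : Fin 4) : inner ℝ (n i) x = edgeCos := (hxn i).symm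
  have hxn' (i : Fin 4) : inner ℝ x (n i) = edgeCos := hxn i
  have hp' := real_inner_comm (n 0) (n 1) ▸ hp
  have hq' := real_inner_comm (n 0) (n 2) ▸ hq
  have hr' := real_inner_comm (n 0) (n 3) ▸ hr
  have hs' := real_inner_comm (n 1) (n 2) ▸ hs
  have ht' := real_inner_comm (n 1) (n 3) ▸ ht
  have hu' := real_inner_comm (n 2) (n 3) ▸ hu
  have e0 := e 0
  have e1 := e 1
  have e2 := e 2
  have e3 := e 3
  change inner ℝ _ (c 0 • x + c 1 • n 0 + c 2 • n 1 + c 3 • n 2 + c 4 • n 3) = _ at hx0 e0 e1 e2 e3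
  simp only [inner_add_right, inner_smul_right, hsq, hxx, hnx, hxn', hp, hq, hr, hs, ht, hu, hp',
    hq', hr', hs', ht', hu', inner_zero_right] at hx0 e0 e1 e2 e3
  apply embR_injective
  rw [map_symmDet, embR_int, embR_int]
  push_cast
  have d := one_sub_edgeCos_sq
  refine symmDet_eq_zero (c := fun i => c i.succ) ?_ ?_ ?_ ?_ ?_
  · by_contra! h
    obtain ⟨i, hi⟩ := hc'
    refine hi ?_
    refine Fin.cases ?_ h i
    have h0 := h 0
    have h1 := h 1
    have h2 := h 2
    have h3 := h 3
    change c 1 = 0 at h0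
    change c 2 = 0 at h1
    change c 3 = 0 at h2
    change c 4 = 0 at h3
    simpa [h0, h1, h2, h3] using hx0
  all_goals
    change _ * c 1 + _ * c 2 + _ * c 3 + _ * c 4 = 0
    refine (mul_right_inj' hk).1 ?_
  · linear_combination e0 - edgeCos * hx0 - c 1 * d - c 2 * nbrCos_sub p - c 3 * nbrCos_sub q -
      c 4 * nbrCos_sub r
  · linear_combination e1 - edgeCos * hx0 - c 1 * nbrCos_sub p - c 2 * d - c 3 * nbrCos_sub s -
      c 4 * nbrCos_sub t
  · linear_combination e2 - edgeCos * hx0 - c 1 * nbrCos_sub q - c 2 * nbrCos_sub s - c 3 * d -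
      c 4 * nbrCos_sub u
  · linear_combination e3 - edgeCos * hx0 - c 1 * nbrCos_sub r - c 2 * nbrCos_sub t -
      c 3 * nbrCos_sub u - c 4 * d

theorem exists_nbrCos {x y : Space} (h : Near x y ∨ NextNear x y) :
    ∃ e, inner ℝ x y = nbrCos e := by
  rcases h with h | h
  · exact ⟨true, h⟩
  · exact ⟨false, h⟩

theorem IsTight.isPath_of_near (hC : IsTight C) {x p q r s : Space} (hx : x ∈ C)
    (hp : p ∈ C) (hq : q ∈ C) (hr : r ∈ C) (hs : s ∈ C)
    (hxp : Near x p) (hxq : Near x q) (hxr : Near x r) (hxs : Near x s)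
    (hpq : Near p q) (hpr : p ≠ r) (hps : p ≠ s) (hqr : q ≠ r) (hqs : q ≠ s) (hrs : r ≠ s) :
    (IsPath p q r s ∨ IsPath p q s r) ∨ (IsPath q p r s ∨ IsPath q p s r) ∨
      (IsPath r p q s ∨ IsPath s p q r) := by
  obtain ⟨e1, h1⟩ := exists_nbrCos (hC.near_or_nextNear hx hp hr hxp hxr hpr)
  obtain ⟨e2, h2⟩ := exists_nbrCos (hC.near_or_nextNear hx hp hs hxp hxs hps)
  obtain ⟨e3, h3⟩ := exists_nbrCos (hC.near_or_nextNear hx hq hr hxq hxr hqr)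
  obtain ⟨e4, h4⟩ := exists_nbrCos (hC.near_or_nextNear hx hq hs hxq hxs hqs)
  obtain ⟨e5, h5⟩ := exists_nbrCos (hC.near_or_nextNear hx hr hs hxr hxs hrs)
  have h := symmDet_gram hC hx (n := ![p, q, r, s]) (p := true) (by simp [Fin.forall_fin_succ, *])
    (by simp [Fin.forall_fin_succ, *]) hpq h1 h2 h3 h4 h5
  have h' := symmDet_gramEntry_eq_zero e1 e2 e3 e4 e5 h
  simp only [List.mem_cons, Prod.mk.injEq, List.not_mem_nil, or_false] at h'
  have hT {x y : Space} {e : Bool} (h : inner ℝ x y = nbrCos e) (he : e = true) : Near x y := by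
    rw [he] at h; exact h
  have hF {x y : Space} {e : Bool} (h : inner ℝ x y = nbrCos e) (he : e = false) :
      NextNear x y := by
    rw [he] at h; exact h
  rcases h' with ⟨f1, f2, f3, f4, f5⟩ | ⟨f1, f2, f3, f4, f5⟩ | ⟨f1, f2, f3, f4, f5⟩ |
    ⟨f1, f2, f3, f4, f5⟩ | ⟨f1, f2, f3, f4, f5⟩ | ⟨f1, f2, f3, f4, f5⟩
  · exact Or.inl (Or.inl ⟨hpq, hT h3 f3, hT h5 f5, hF h1 f1, hF h2 f2, hF h4 f4⟩)
  · exact Or.inl (Or.inr ⟨hpq, hT h4 f4, (hT h5 f5).symm, hF h2 f2, hF h1 f1, hF h3 f3⟩)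
  · exact Or.inr (Or.inl (Or.inl ⟨hpq.symm, hT h1 f1, hT h5 f5, hF h3 f3, hF h4 f4, hF h2 f2⟩))
  · exact Or.inr (Or.inl (Or.inr ⟨hpq.symm, hT h2 f2, (hT h5 f5).symm, hF h4 f4, hF h3 f3,
      hF h1 f1⟩))
  · exact Or.inr (Or.inr (Or.inl ⟨(hT h1 f1).symm, hpq, hT h4 f4, (hF h3 f3).symm,
      (hF h5 f5), hF h2 f2⟩))
  · exact Or.inr (Or.inr (Or.inr ⟨(hT h2 f2).symm, hpq, hT h3 f3, (hF h4 f4).symm,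
      (hF h5 f5).symm, hF h1 f1⟩))

theorem phi_bounds : 1.618 < phi ∧ phi < 1.6181 := by
  have := sqrt_five_bounds
  rw [phi]; constructor <;> linarith

theorem IsTight.inner_self (hC : IsTight C) {x : Space} (hx : x ∈ C) : inner ℝ x x = 1 := by
  rw [real_inner_self_eq_norm_sq, hC.norm_eq x hx, one_pow]

theorem IsPath.sub_eq {p q r s : Space} (h : IsPath p q r s) (hp : inner ℝ p p = 1)
    (hq : inner ℝ q q = 1) (hr : inner ℝ r r = 1) (hs : inner ℝ s s = 1) :
    p - s = phi • (q - r) := by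
  rw [← sub_eq_zero, ← inner_self_eq_zero (𝕜 := ℝ)]
  have e1 : inner ℝ p q = edgeCos := h.h₁
  have e2 : inner ℝ q r = edgeCos := h.h₂
  have e3 : inner ℝ r s = edgeCos := h.h₃
  have e4 : inner ℝ p r = secondCos := h.h₄
  have e5 : inner ℝ p s = secondCos := h.h₅
  have e6 : inner ℝ q s = secondCos := h.h₆
  have f1 : inner ℝ q p = edgeCos := h.h₁.symm
  have f2 : inner ℝ r q = edgeCos := h.h₂.symm
  have f3 : inner ℝ s r = edgeCos := h.h₃.symm
  have f4 : inner ℝ r p = secondCos := h.h₄.symm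
  have f5 : inner ℝ s p = secondCos := h.h₅.symm
  have f6 : inner ℝ s q = secondCos := h.h₆.symm
  simp only [inner_sub_left, inner_sub_right, real_inner_smul_left, real_inner_smul_right, e1, e2,
    e3, e4, e5, e6, f1, f2, f3, f4, f5, f6, hp, hq, hr, hs]
  rw [phi, edgeCos, secondCos]
  linear_combination (-(3 * √5 + 7) / 16) * sqrt_five_sq

theorem mem_nbrs {x y : Space} : y ∈ nbrs C x ↔ y ∈ C ∧ Near x y := Finset.mem_filter

theorem IsTight.not_isPath_of_near_of_nextNear (hC : IsTight C) {x p q r s v : Space}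
    (hx : x ∈ C) (hp : p ∈ C) (hq : q ∈ C) (hr : r ∈ C) (hs : s ∈ C) (hv : v ∈ C)
    (hxp : Near x p) (hxq : Near x q) (hxs : Near x s) (hxr : Near x r)
    (h : IsPath p q r s) (hpv : Near p v) (hvq : Near v q) (hvx : NextNear v x) : False := by
  have hvr : v ≠ r := by rintro rfl; exact hpv.not_nextNear h.h₄
  have hvs : v ≠ s := by rintro rfl; exact hpv.not_nextNear h.h₅
  have hpath : IsPath v p x r := by
    rcases hC.isPath_of_near hq hp hx hv hr h.h₁.symm hxq.symm hvq.symm h.h₂ hxp.symm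
      (hC.ne_of_near hp hpv) (hC.ne_of_nextNear hp h.h₄) (hC.ne_of_nextNear hv hvx).symm
      (hC.ne_of_near hx hxr) hvr with (k | k) | (k | k) | (k | k)
    · exact absurd hvx (k.h₂.symm.not_nextNear)
    · exact absurd k.h₅ hpv.not_nextNear
    · exact absurd k.h₅ hxr.not_nextNear
    · exact absurd h.h₄ k.h₂.not_nextNear
    · exact k
    · exact absurd h.h₄ k.h₁.symm.not_nextNear
  have key := congrArg (fun w => inner ℝ w s) (hpath.sub_eq (hC.inner_self hv) (hC.inner_self hp)
    (hC.inner_self hx) (hC.inner_self hr))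
  have e1 : inner ℝ r s = edgeCos := h.h₃
  have e2 : inner ℝ p s = secondCos := h.h₅
  have e3 : inner ℝ x s = edgeCos := hxs
  simp only [inner_sub_left, real_inner_smul_left, e1, e2, e3] at key
  have ha := edgeCos_bounds
  have hb := secondCos_bounds
  have hφ := phi_bounds
  have h1 : inner ℝ v s < 0.88 ∧ 0.85 < inner ℝ v s := by constructor <;> nlinarith
  rcases hC.near_or hv hs hvs with k | k | k
  · rw [Near] at k; linarith
  · rw [NextNear] at k; linarith
  · linarith

theorem IsTight.not_isPath_of_isPath (hC : IsTight C) {x p q r s v w : Space}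
    (hx : x ∈ C) (hp : p ∈ C) (hq : q ∈ C) (hr : r ∈ C) (hv : v ∈ C) (hw : w ∈ C)
    (hxp : Near x p) (hxq : Near x q) (hxr : Near x r)
    (h : IsPath p q r s) (hpv : Near p v) (hpw : Near p w) (h' : IsPath q x v w) : False := by
  have hvr : v ≠ r := by rintro rfl; exact hpv.not_nextNear h.h₄
  have hwr : w ≠ r := by rintro rfl; exact hpw.not_nextNear h.h₄
  have hqv : q ≠ v := hC.ne_of_nextNear hq h'.h₄
  have hpath : IsPath v p q r := by
    rcases hC.isPath_of_near hx hp hq hv hr hxp hxq h'.h₂ hxr h.h₁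
      (hC.ne_of_near hp hpv) (hC.ne_of_nextNear hp h.h₄) hqv
      (hC.ne_of_near hq h.h₂) hvr with (k | k) | (k | k) | (k | k)
    · exact absurd h'.h₄ k.h₂.not_nextNear
    · exact absurd k.h₅ hpv.not_nextNear
    · exact absurd k.h₅ h.h₂.not_nextNear
    · exact absurd h.h₄ k.h₂.not_nextNear
    · exact k
    · exact absurd h.h₄ k.h₁.symm.not_nextNear
  have key := congrArg (fun w => inner ℝ w r) (h'.sub_eq (hC.inner_self hq) (hC.inner_self hx)
    (hC.inner_self hv) (hC.inner_self hw))
  have e1 : inner ℝ q r = edgeCos := h.h₂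
  have e2 : inner ℝ v r = secondCos := hpath.h₅
  have e3 : inner ℝ x r = edgeCos := hxr
  simp only [inner_sub_left, real_inner_smul_left, e1, e2, e3] at key
  have ha := edgeCos_bounds
  have hb := secondCos_bounds
  have hφ := phi_bounds
  have h1 : inner ℝ w r < 0.88 ∧ 0.85 < inner ℝ w r := by constructor <;> nlinarith
  rcases hC.near_or hw hr hwr with k | k | k
  · rw [Near] at k; linarith
  · rw [NextNear] at k; linarith
  · linarith

theorem IsTight.exists_two_nbrs (hC : IsTight C) {x n m : Space} (hx : x ∈ C) :
    ∃ v w, (v ∈ C ∧ Near x v) ∧ (w ∈ C ∧ Near x w) ∧ v ≠ w ∧ n ≠ v ∧ n ≠ w ∧ m ≠ v ∧ m ≠ w := by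
  have h : 1 < ((nbrs C x) \ {n, m}).card := by
    have h1 := Finset.le_card_sdiff {n, m} (nbrs C x)
    have h2 : ({n, m} : Finset Space).card ≤ 2 := Finset.card_le_two
    have h3 := hC.four_le_card_nbrs hx
    omega
  obtain ⟨v, hv, w, hw, hvw⟩ := Finset.one_lt_card.1 h
  simp only [Finset.mem_sdiff, mem_nbrs, Finset.mem_insert, Finset.mem_singleton, not_or] at hv hw
  exact ⟨v, w, hv.1, hw.1, hvw, Ne.symm hv.2.1, Ne.symm hw.2.1, Ne.symm hv.2.2, Ne.symm hw.2.2⟩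

theorem IsTight.not_isPath (hC : IsTight C) {x p q r s : Space}
    (hx : x ∈ C) (hp : p ∈ C) (hq : q ∈ C) (hr : r ∈ C) (hs : s ∈ C)
    (hxp : Near x p) (hxq : Near x q) (hxr : Near x r) (hxs : Near x s) : ¬ IsPath p q r s := by
  intro h
  obtain ⟨v, w, ⟨hv, hpv⟩, ⟨hw, hpw⟩, hvw, hqv, hqw, hxv, hxw⟩ :=
    hC.exists_two_nbrs (n := q) (m := x) hp
  have hqx := hC.ne_of_near hq hxq.symm
  rcases hC.isPath_of_near hp hq hx hv hw h.h₁ hxp.symm hpv hpw hxq.symm hqv hqw hxv hxw hvw with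
    (k | k) | (k | k) | (k | k)
  · exact hC.not_isPath_of_isPath hx hp hq hr hv hw hxp hxq hxr h hpv hpw k
  · exact hC.not_isPath_of_isPath hx hp hq hr hw hv hxp hxq hxr h hpw hpv k
  · exact hC.not_isPath_of_near_of_nextNear hx hp hq hr hs hv hxp hxq hxs hxr h hpv k.h₂.symm
      k.h₄.symm
  · exact hC.not_isPath_of_near_of_nextNear hx hp hq hr hs hw hxp hxq hxs hxr h hpw k.h₂.symm
      k.h₄.symm
  · exact hC.not_isPath_of_near_of_nextNear hx hp hq hr hs hv hxp hxq hxs hxr h hpv k.h₁ k.h₄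
  · exact hC.not_isPath_of_near_of_nextNear hx hp hq hr hs hw hxp hxq hxs hxr h hpw k.h₁ k.h₄

theorem IsTight.nextNear_of_near (hC : IsTight C) {x n m : Space} (hx : x ∈ C) (hn : n ∈ C)
    (hm : m ∈ C) (hxn : Near x n) (hxm : Near x m) (hnm : n ≠ m) : NextNear n m := by
  refine (hC.near_or_nextNear hx hn hm hxn hxm hnm).resolve_left fun h => ?_
  obtain ⟨v, w, ⟨hv, hxv⟩, ⟨hw, hxw⟩, hvw, hnv, hnw, hmv, hmw⟩ :=
    hC.exists_two_nbrs (n := n) (m := m) hx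
  rcases hC.isPath_of_near hx hn hm hv hw hxn hxm hxv hxw h hnv hnw hmv hmw hvw with
    (k | k) | (k | k) | (k | k)
  · exact hC.not_isPath hx hn hm hv hw hxn hxm hxv hxw k
  · exact hC.not_isPath hx hn hm hw hv hxn hxm hxw hxv k
  · exact hC.not_isPath hx hm hn hv hw hxm hxn hxv hxw k
  · exact hC.not_isPath hx hm hn hw hv hxm hxn hxw hxv k
  · exact hC.not_isPath hx hv hn hm hw hxv hxn hxm hxw k
  · exact hC.not_isPath hx hw hn hm hv hxw hxn hxm hxv k

/-- Four unit vectors around `x`, arranged as the neighbours of a vertex of the 120-cell. -/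
structure IsFrame (x : Space) (n : Fin 4 → Space) : Prop where
  inner_self : inner ℝ x x = 1
  inner_nbr_self : ∀ i, inner ℝ (n i) (n i) = 1
  inner_nbr : ∀ i, inner ℝ x (n i) = edgeCos
  inner_nbr_nbr : ∀ i j, i ≠ j → inner ℝ (n i) (n j) = secondCos

theorem IsFrame.inner_nbr' {x : Space} {n : Fin 4 → Space} (h : IsFrame x n) (i : Fin 4) :
    inner ℝ (n i) x = edgeCos := by
  rw [real_inner_comm, h.inner_nbr]

theorem IsFrame.inner_nbr_nbr_eq {x : Space} {n : Fin 4 → Space} (h : IsFrame x n)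
    (i j : Fin 4) : inner ℝ (n i) (n j) = secondCos + if i = j then 1 - secondCos else 0 := by
  split_ifs with hij
  · rw [hij, h.inner_nbr_self]; ring
  · rw [h.inner_nbr_nbr i j hij, add_zero]

theorem IsFrame.sum_eq {x : Space} {n : Fin 4 → Space} (h : IsFrame x n) :
    ∑ i, n i = (4 * edgeCos) • x := by
  rw [← sub_eq_zero, ← inner_self_eq_zero (𝕜 := ℝ)]
  simp only [inner_sub_left, inner_sub_right, real_inner_smul_left, real_inner_smul_right,
    sum_inner, inner_sum, h.inner_nbr_nbr_eq, h.inner_nbr, h.inner_nbr', h.inner_self,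
    Finset.sum_add_distrib, Finset.sum_sub_distrib, Finset.sum_ite_eq', Finset.mem_univ, if_true,
    Finset.sum_const, Finset.card_univ, Fintype.card_fin, nsmul_eq_mul]
  rw [edgeCos, secondCos]
  push_cast
  linear_combination (-9 / 4) * sqrt_five_sq

theorem IsTight.isFrame (hC : IsTight C) {x : Space} (hx : x ∈ C) {n : Fin 4 → Space}
    (hn : ∀ i, n i ∈ nbrs C x) (hinj : Function.Injective n) : IsFrame x n where
  inner_self := hC.inner_self hx
  inner_nbr_self i := hC.inner_self (mem_nbrs.1 (hn i)).1
  inner_nbr i := (mem_nbrs.1 (hn i)).2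
  inner_nbr_nbr i j hij := hC.nextNear_of_near hx (mem_nbrs.1 (hn i)).1 (mem_nbrs.1 (hn j)).1
    (mem_nbrs.1 (hn i)).2 (mem_nbrs.1 (hn j)).2 (hinj.ne hij)

theorem IsTight.card_nbrs (hC : IsTight C) {x : Space} (hx : x ∈ C) : (nbrs C x).card = 4 := by
  refine le_antisymm ?_ (hC.four_le_card_nbrs hx)
  by_contra! h
  obtain ⟨s, hs, hcard⟩ := Finset.exists_subset_card_eq (Nat.succ_le_of_lt h)
  set e := (s.equivFinOfCardEq hcard).symm
  have hmem (i : Fin 5) : (e i : Space) ∈ nbrs C x := hs (e i).2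
  have hinj : Function.Injective fun i => (e i : Space) :=
    Subtype.val_injective.comp e.injective
  have h1 := (hC.isFrame hx (n := fun i => e (Fin.castSucc i)) (fun i => hmem _)
    (hinj.comp (Fin.castSucc_injective 4))).sum_eq
  have h2 := (hC.isFrame hx (n := fun i => e (Fin.succ i)) (fun i => hmem _)
    (hinj.comp (Fin.succ_injective 4))).sum_eq
  have h3 := h1.trans h2.symm
  have h4 : (e 0 : Space) = e 4 := by
    simp only [Fin.sum_univ_four] at h3
    change (e 0 : Space) + e 1 + e 2 + e 3 = e 1 + e 2 + e 3 + e 4 at h3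
    have : (e 0 : Space) + (e 1 + e 2 + e 3) = e 4 + (e 1 + e 2 + e 3) := by
      rw [← add_assoc, ← add_assoc, h3]; abel
    exact add_right_cancel this
  exact absurd (hinj h4) (by decide)

theorem IsTight.exists_isFrame (hC : IsTight C) {x : Space} (hx : x ∈ C) :
    ∃ n : Fin 4 → Space, IsFrame x n ∧ nbrs C x = Finset.univ.image n := by
  set e := ((nbrs C x).equivFinOfCardEq (hC.card_nbrs hx)).symm
  refine ⟨fun i => e i, hC.isFrame hx (fun i => (e i).2)
    (Subtype.val_injective.comp e.injective), ?_⟩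
  ext y
  simp only [Finset.mem_image, Finset.mem_univ, true_and]
  exact ⟨fun hy => ⟨e.symm ⟨y, hy⟩, by simp⟩, by rintro ⟨i, rfl⟩; exact (e i).2⟩

/-- The constant in the expansion of a vector in terms of a frame. -/
noncomputable def frameConst : ℝ := 6 + 2 * √5

/-- The vector with given product with `x` and given coordinates in terms of a frame. -/
noncomputable def ofCoords (x : Space) (n : Fin 4 → Space) (c : ℝ) (p : Fin 4 → ℝ) : Space :=
  c • x + ∑ i, (frameConst * p i) • (n i - edgeCos • x)

/-- The products of `v` with the projections of the vectors of a frame. -/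
noncomputable def frameCoord (x : Space) (n : Fin 4 → Space) (v : Space) (i : Fin 4) : ℝ :=
  inner ℝ v (n i) - edgeCos * inner ℝ v x

section Frame

variable {x : Space} {n : Fin 4 → Space}

theorem IsFrame.inner_ofCoords (h : IsFrame x n) (c : ℝ) (p : Fin 4 → ℝ) :
    inner ℝ (ofCoords x n c p) x = c := by
  simp only [ofCoords, inner_add_left, sum_inner, inner_sub_left, real_inner_smul_left,
    h.inner_self, h.inner_nbr', mul_one, sub_self, mul_zero, Finset.sum_const_zero, add_zero]

theorem IsFrame.inner_ofCoords_nbr (h : IsFrame x n) (c : ℝ) {p : Fin 4 → ℝ}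
    (hp : ∑ i, p i = 0) (j : Fin 4) :
    inner ℝ (ofCoords x n c p) (n j) = p j + edgeCos * c := by
  have e (i : Fin 4) : frameConst * p i * (secondCos + (if i = j then 1 - secondCos else 0) -
      edgeCos * edgeCos) = (-1 / 4) * p i + if i = j then p i else 0 := by
    rw [frameConst, secondCos, edgeCos]
    split_ifs
    · linear_combination (-33 * p i / 32 - 9 * √5 * p i / 32) * sqrt_five_sq
    · linear_combination (-25 * p i / 32 - 9 * √5 * p i / 32) * sqrt_five_sq
  simp only [ofCoords, inner_add_left, sum_inner, inner_sub_left, real_inner_smul_left,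
    h.inner_nbr, h.inner_nbr_nbr_eq, e, Finset.sum_add_distrib, Finset.sum_ite_eq',
    Finset.mem_univ, if_true, ← Finset.mul_sum, hp]
  ring

theorem IsFrame.sum_frameCoord (h : IsFrame x n) (v : Space) : ∑ i, frameCoord x n v i = 0 := by
  simp only [frameCoord, Finset.sum_sub_distrib, ← inner_sum, h.sum_eq, real_inner_smul_right]
  rw [Finset.sum_const, Finset.card_univ, Fintype.card_fin, nsmul_eq_mul]
  push_cast
  ring

theorem IsFrame.eq_zero (h : IsFrame x n) {u : Space} (hx : inner ℝ u x = 0)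
    (hn : ∀ i, inner ℝ u (n i) = 0) : u = 0 := by
  obtain ⟨c, hc, i, hi⟩ := exists_linear_dependence ![x, n 0, n 1, n 2, u]
  rw [Fin.sum_univ_five] at hc
  change c 0 • x + c 1 • n 0 + c 2 • n 1 + c 3 • n 2 + c 4 • u = 0 at hc
  have eu := congrArg (fun v => inner ℝ u v) hc
  have ex := congrArg (fun v => inner ℝ x v) hc
  have e0 := congrArg (fun v => inner ℝ (n 0) v) hc
  have e1 := congrArg (fun v => inner ℝ (n 1) v) hc
  have e2 := congrArg (fun v => inner ℝ (n 2) v) hc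
  have hxu : inner ℝ x u = 0 := by rw [real_inner_comm, hx]
  have hnu (i : Fin 4) : inner ℝ (n i) u = 0 := by rw [real_inner_comm, hn]
  simp only [inner_add_right, real_inner_smul_right, hx, hn, hxu, hnu, inner_zero_right,
    h.inner_self, h.inner_nbr, h.inner_nbr', h.inner_nbr_self,
    h.inner_nbr_nbr 0 1 (by decide), h.inner_nbr_nbr 0 2 (by decide),
    h.inner_nbr_nbr 1 0 (by decide), h.inner_nbr_nbr 1 2 (by decide),
    h.inner_nbr_nbr 2 0 (by decide), h.inner_nbr_nbr 2 1 (by decide)] at eu ex e0 e1 e2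
  by_contra hu
  have hu' : inner ℝ u u ≠ 0 := fun k => hu (inner_self_eq_zero.1 k)
  have c4 : c 4 = 0 := by
    have : c 4 * inner ℝ u u = 0 := by linarith
    exact (mul_eq_zero.1 this).resolve_right hu'
  have hb : 1 - secondCos ≠ 0 := by
    have := secondCos_bounds
    have : 0 < 1 - secondCos := by linarith
    exact this.ne'
  have h12 : c 1 = c 2 := by
    refine (mul_right_inj' hb).1 ?_
    linear_combination e0 - e1
  have h13 : c 1 = c 3 := by
    refine (mul_right_inj' hb).1 ?_
    linear_combination e0 - e2
  have hab : 1 + 2 * secondCos - 3 * edgeCos ^ 2 ≠ 0 := by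
    have := edgeCos_bounds
    have := secondCos_bounds
    have : 0 < 1 + 2 * secondCos - 3 * edgeCos ^ 2 := by nlinarith
    exact this.ne'
  have c1 : c 1 = 0 := by
    refine (mul_eq_zero.1 ?_).resolve_left hab
    rw [← h12, ← h13] at ex e0
    linear_combination e0 - edgeCos * ex
  have c0 : c 0 = 0 := by
    rw [← h12, ← h13, c1, c4] at ex
    linarith
  have key : ∀ j, c j = 0 := by
    intro j
    fin_cases j
    exacts [c0, c1, h12 ▸ c1, h13 ▸ c1, c4]
  exact hi (key i)

theorem IsFrame.eq_ofCoords (h : IsFrame x n) (v : Space) :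
    v = ofCoords x n (inner ℝ v x) (frameCoord x n v) := by
  rw [← sub_eq_zero]
  refine h.eq_zero ?_ fun i => ?_
  · rw [inner_sub_left, h.inner_ofCoords, sub_self]
  · rw [inner_sub_left, h.inner_ofCoords_nbr _ (h.sum_frameCoord v), frameCoord]
    ring

theorem IsFrame.ext (h : IsFrame x n) {v w : Space} (hx : inner ℝ v x = inner ℝ w x)
    (hn : ∀ i, inner ℝ v (n i) = inner ℝ w (n i)) : v = w := by
  rw [← sub_eq_zero]
  exact h.eq_zero (by rw [inner_sub_left, hx, sub_self])
    fun i => by rw [inner_sub_left, hn, sub_self]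

theorem IsFrame.inner_eq (h : IsFrame x n) (v w : Space) : inner ℝ v w =
    inner ℝ v x * inner ℝ w x + frameConst * ∑ i, frameCoord x n v i * frameCoord x n w i := by
  conv_lhs => rw [h.eq_ofCoords v]
  simp only [ofCoords, inner_add_left, sum_inner, inner_sub_left, real_inner_smul_left,
    Finset.mul_sum]
  rw [real_inner_comm w x]
  congr 1
  refine Finset.sum_congr rfl fun i _ => ?_
  rw [frameCoord, frameCoord, real_inner_comm w (n i)]
  ring

end Frame

theorem embR_second : embR ⟨5, 1⟩ / 8 = secondCos := by
  rw [embR_mk, secondCos]; push_cast; ring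

theorem dihedral_cases : ∀ s ∈ ipRoots, ∀ t ∈ ipRoots,
    s * s + t * t + (⟨9, 5⟩ - s - t) * (⟨9, 5⟩ - s - t) = ⟨78, 26⟩ →
    s = ⟨5, 1⟩ ∧ t = ⟨2, 2⟩ ∨ s = ⟨2, 2⟩ ∧ t = ⟨5, 1⟩ ∨ s = ⟨2, 2⟩ ∧ t = ⟨2, 2⟩ := by
  decide

/-- The third largest inner product between distinct vertices of the 120-cell. -/
noncomputable def thirdCos : ℝ := (2 + 2 * √5) / 8

theorem embR_third : embR ⟨2, 2⟩ / 8 = thirdCos := by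
  rw [embR_mk, thirdCos]; push_cast; ring

/-- The inner products of a neighbour of `n i`, other than `x`, with the vectors of a frame. -/
noncomputable def frameProfile (i j l : Fin 4) : ℝ :=
  if l = i then edgeCos else if l = j then secondCos else thirdCos

theorem sum_univ_four_shift (f : Fin 4 → ℝ) (i : Fin 4) :
    ∑ l, f l = f i + f (i + 1) + f (i + 2) + f (i + 3) := by
  rw [Fin.sum_univ_four]
  fin_cases i <;> simp <;> ring

theorem four_shift_ne : ∀ i : Fin 4, (i + 1 ≠ i ∧ i + 2 ≠ i ∧ i + 3 ≠ i) ∧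
    i + 1 ≠ i + 2 ∧ i + 1 ≠ i + 3 ∧ i + 2 ≠ i + 3 := by decide

theorem four_shift_cases : ∀ i l : Fin 4, l = i ∨ l = i + 1 ∨ l = i + 2 ∨ l = i + 3 := by
  decide

theorem forall_frameProfile {f : Fin 4 → ℝ} {i j : Fin 4} (hi : f i = edgeCos)
    (h1 : f (i + 1) = if i + 1 = j then secondCos else thirdCos)
    (h2 : f (i + 2) = if i + 2 = j then secondCos else thirdCos)
    (h3 : f (i + 3) = if i + 3 = j then secondCos else thirdCos) (l : Fin 4) :
    f l = frameProfile i j l := by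
  obtain ⟨⟨k1, k2, k3⟩, -⟩ := four_shift_ne i
  rw [frameProfile]
  rcases four_shift_cases i l with rfl | rfl | rfl | rfl
  · rw [if_pos rfl, hi]
  · rw [if_neg k1, h1]
  · rw [if_neg k2, h2]
  · rw [if_neg k3, h3]

theorem IsTight.exists_frameProfile (hC : IsTight C) {x z : Space} {n : Fin 4 → Space}
    (h : IsFrame x n) (hx : x ∈ C) (hn : ∀ l, n l ∈ C) {i : Fin 4} (hz : z ∈ C)
    (hzi : Near (n i) z) (hzx : x ≠ z) :
    inner ℝ z x = secondCos ∧ ∃ j, j ≠ i ∧ ∀ l, inner ℝ z (n l) = frameProfile i j l := by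
  have hb : inner ℝ z x = secondCos :=
    (hC.nextNear_of_near (hn i) hx hz (h.inner_nbr' i) hzi hzx).symm
  have ha : inner ℝ z (n i) = edgeCos := hzi.symm
  obtain ⟨⟨k1, k2, k3⟩, k4, k5, k6⟩ := four_shift_ne i
  refine ⟨hb, ?_⟩
  have hs (l : Fin 4) (hl : l ≠ i) : ∃ s ∈ ipRoots, inner ℝ z (n l) = embR s / 8 := by
    refine hC.inner_eq z hz (n l) (hn l) ?_
    rintro rfl
    have := h.inner_nbr l
    rw [real_inner_comm, hb] at this
    have := edgeCos_bounds
    have := secondCos_bounds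
    linarith
  obtain ⟨s, hs1, hs2⟩ := hs (i + 1) k1
  obtain ⟨t, ht1, ht2⟩ := hs (i + 2) k2
  obtain ⟨u, hu1, hu2⟩ := hs (i + 3) k3
  have hsum := h.sum_frameCoord z
  have hsq := h.inner_eq z z
  rw [sum_univ_four_shift _ i] at hsum hsq
  simp only [frameCoord, ha, hb, hs2, ht2, hu2, hC.inner_self hz] at hsum hsq
  have hu : u = ⟨9, 5⟩ - s - t := by
    apply embR_injective
    rw [map_sub, map_sub, embR_mk 9 5]
    rw [edgeCos, secondCos] at hsum
    push_cast
    linear_combination 8 * hsum + 3 / 2 * sqrt_five_sq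
  have hk : frameConst ≠ 0 := by
    have := sqrt_five_bounds
    have : 0 < frameConst := by rw [frameConst]; linarith
    exact this.ne'
  have hu' : embR u = 9 + 5 * √5 - embR s - embR t := by
    rw [hu, map_sub, map_sub, embR_mk 9 5]
    push_cast
    ring
  have hq : s * s + t * t + (⟨9, 5⟩ - s - t) * (⟨9, 5⟩ - s - t) = ⟨78, 26⟩ := by
    rw [← hu]
    apply embR_injective
    rw [map_add, map_add, map_mul, map_mul, map_mul, embR_mk 78 26]
    refine (mul_right_inj' hk).1 ?_
    rw [edgeCos, secondCos] at hsum hsq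
    push_cast
    rw [frameConst] at hsq ⊢
    linear_combination (-64) * hsq +
      (15 / 2 + 53 / 2 * √5 + 25 / 2 * √5 ^ 2 + 3 / 2 * √5 ^ 3) * hu' +
      (-9 / 8 * √5 ^ 3 - 27 / 8 * √5 ^ 2 + 157 / 8 * √5 + 591 / 8) * sqrt_five_sq
  rcases dihedral_cases s hs1 t ht1 hq with ⟨rfl, rfl⟩ | ⟨rfl, rfl⟩ | ⟨rfl, rfl⟩
  · exact ⟨i + 1, k1, forall_frameProfile ha (by rw [if_pos rfl, hs2, embR_second])
      (by rw [if_neg k4.symm, ht2, embR_third])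
      (by rw [if_neg k5.symm, hu2, hu, ← embR_third]; rfl)⟩
  · exact ⟨i + 2, k2, forall_frameProfile ha (by rw [if_neg k4, hs2, embR_third])
      (by rw [if_pos rfl, ht2, embR_second])
      (by rw [if_neg k6.symm, hu2, hu, ← embR_third]; rfl)⟩
  · exact ⟨i + 3, k3, forall_frameProfile ha (by rw [if_neg k5, hs2, embR_third])
      (by rw [if_neg k6, ht2, embR_third])
      (by rw [if_pos rfl, hu2, hu, ← embR_second]; rfl)⟩

theorem IsTight.exists_mem_of_frameProfile (hC : IsTight C) {x : Space} {n : Fin 4 → Space}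
    (h : IsFrame x n) (hx : x ∈ C) (hn : ∀ l, n l ∈ C) {i j : Fin 4} (hj : j ≠ i) :
    ∃ z ∈ C, inner ℝ z x = secondCos ∧ ∀ l, inner ℝ z (n l) = frameProfile i j l := by
  have hxi : x ∈ nbrs C (n i) := mem_nbrs.2 ⟨hx, h.inner_nbr' i⟩
  have key (z : Space) : ∃ k, z ∈ (nbrs C (n i)).erase x →
      k ≠ i ∧ inner ℝ z x = secondCos ∧ ∀ l, inner ℝ z (n l) = frameProfile i k l := by
    by_cases hz : z ∈ (nbrs C (n i)).erase x
    · rw [Finset.mem_erase, mem_nbrs] at hz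
      obtain ⟨hb, k, hk, hk'⟩ := hC.exists_frameProfile h hx hn hz.2.1 hz.2.2 hz.1.symm
      exact ⟨k, fun _ => ⟨hk, hb, hk'⟩⟩
    · exact ⟨0, fun h => absurd h hz⟩
  choose f hf using key
  have hsurj := Finset.surjOn_of_injOn_of_card_le (s := (nbrs C (n i)).erase x)
    (t := Finset.univ.erase i) f (fun z hz => by simpa using (hf z hz).1) ?_ ?_
  · obtain ⟨z, hz, hz'⟩ := hsurj (show j ∈ _ by simpa using hj)
    refine ⟨z, (mem_nbrs.1 (Finset.mem_of_mem_erase hz)).1, ?_⟩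
    rw [← hz']
    exact (hf z hz).2
  · intro z hz w hw hzw
    obtain ⟨-, hz1, hz2⟩ := hf z hz
    obtain ⟨-, hw1, hw2⟩ := hf w hw
    exact h.ext (hz1.trans hw1.symm) fun l => by rw [hz2, hw2, hzw]
  · rw [Finset.card_erase_of_mem hxi, hC.card_nbrs (hn i), Finset.card_erase_of_mem (by simp)]
    simp

/-- If two tight configurations share a point and all its neighbours, then they share all the
neighbours of those neighbours. -/
theorem IsTight.nbrs_subset (hC : IsTight C) {D : Finset Space} (hD : IsTight D) {x y : Space}
    (hxC : x ∈ C) (hxD : x ∈ D) (h : nbrs D x ⊆ C) (hy : y ∈ nbrs D x) : nbrs D y ⊆ C := by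
  obtain ⟨n, hn, himage⟩ := hD.exists_isFrame hxD
  have hnD (l : Fin 4) : n l ∈ nbrs D x := himage ▸ Finset.mem_image_of_mem n (Finset.mem_univ l)
  obtain ⟨i, -, rfl⟩ := Finset.mem_image.1 (himage ▸ hy)
  intro z hz
  rw [mem_nbrs] at hz
  by_cases hzx : x = z
  · exact hzx ▸ hxC
  obtain ⟨hb, j, hj, hprofile⟩ := hD.exists_frameProfile hn hxD (fun l => (mem_nbrs.1 (hnD l)).1)
    hz.1 hz.2 hzx
  obtain ⟨w, hw, hw1, hw2⟩ := hC.exists_mem_of_frameProfile hn hxC (fun l => h (hnD l)) hj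
  rwa [hn.ext (hb.trans hw1.symm) fun l => by rw [hprofile, hw2]]

/-- A nonempty part of a tight configuration that is closed under taking neighbours is the whole
configuration. -/
theorem IsTight.subset_of_nbrs_subset {D K : Finset Space} (hD : IsTight D) (hKD : K ⊆ D)
    (hK : K.Nonempty) (h : ∀ x ∈ K, nbrs D x ⊆ K) : D ⊆ K := by
  intro v hv
  by_contra hvK
  obtain ⟨x, hx, hmax⟩ := K.exists_max_image (fun y => inner ℝ v y) hK
  obtain ⟨n, hn, himage⟩ := hD.exists_isFrame (hKD hx)
  have hnK (i : Fin 4) : n i ∈ K :=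
    h x hx (himage ▸ Finset.mem_image_of_mem n (Finset.mem_univ i))
  have hsum := hn.sum_frameCoord v
  have hsq := hn.inner_eq v v
  have hp (i : Fin 4) : frameCoord x n v i ≤ inner ℝ v x * (1 - edgeCos) := by
    have := hmax (n i) (hnK i)
    rw [frameCoord]
    linarith
  have hc : inner ℝ v x ≤ secondCos := by
    have hxv : x ≠ v := fun k => hvK (k ▸ hx)
    rw [real_inner_comm]
    rcases hD.near_or (hKD hx) hv hxv with k | k | k
    · exact absurd (h x hx (mem_nbrs.2 ⟨hv, k⟩)) hvK
    · exact k.le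
    · have := secondCos_bounds
      linarith
  rw [hD.inner_self hv] at hsq
  set c := inner ℝ v x
  have h0 := hp 0
  have h1 := hp 1
  have h2 := hp 2
  have h3 := hp 3
  rw [Fin.sum_univ_four] at hsum hsq
  set p := frameCoord x n v
  have ha := edgeCos_bounds
  have hb := secondCos_bounds
  have h5 := sqrt_five_bounds
  have hm : 0 ≤ c * (1 - edgeCos) := by linarith
  have hc0 : 0 ≤ c := by nlinarith
  have hle : p 0 * p 0 + p 1 * p 1 + p 2 * p 2 + p 3 * p 3 ≤ 12 * (c * (1 - edgeCos)) ^ 2 := by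
    generalize c * (1 - edgeCos) = m at *
    have e : p 3 = -(p 0 + p 1 + p 2) := by linarith
    nlinarith [mul_nonneg (sub_nonneg.2 h0) (sub_nonneg.2 h1),
      mul_nonneg (sub_nonneg.2 h0) (sub_nonneg.2 h2),
      mul_nonneg (sub_nonneg.2 h0) (sub_nonneg.2 h3),
      mul_nonneg (sub_nonneg.2 h1) (sub_nonneg.2 h2),
      mul_nonneg (sub_nonneg.2 h1) (sub_nonneg.2 h3),
      mul_nonneg (sub_nonneg.2 h2) (sub_nonneg.2 h3)]
  have hk : 0 < frameConst ∧ frameConst < 10.5 := by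
    rw [frameConst]; constructor <;> linarith
  have hc2 : c ^ 2 ≤ 0.82 := by nlinarith
  have ha2 : (1 - edgeCos) ^ 2 ≤ 0.0014 := by nlinarith
  have hca : (c * (1 - edgeCos)) ^ 2 ≤ 0.82 * 0.0014 := by
    rw [mul_pow]
    exact mul_le_mul hc2 ha2 (sq_nonneg _) (by norm_num)
  have hfin : frameConst * (p 0 * p 0 + p 1 * p 1 + p 2 * p 2 + p 3 * p 3) ≤
      10.5 * (12 * (0.82 * 0.0014)) :=
    mul_le_mul hk.2.le (hle.trans (by linarith)) (add_nonneg (add_nonneg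
      (add_nonneg (mul_self_nonneg _) (mul_self_nonneg _)) (mul_self_nonneg _)) (mul_self_nonneg _))
      (by norm_num)
  nlinarith

theorem IsFrame.exists_linearIsometryEquiv {x y : Space} {n m : Fin 4 → Space} (h : IsFrame x n)
    (h' : IsFrame y m) : ∃ O : Space ≃ₗᵢ[ℝ] Space, O x = y ∧ ∀ i, O (n i) = m i := by
  let A : Space →ₗ[ℝ] Space :=
    { toFun := fun v => ofCoords y m (inner ℝ v x) (frameCoord x n v)
      map_add' := fun v w => by
        simp only [ofCoords, frameCoord, inner_add_left]
        rw [add_add_add_comm, ← Finset.sum_add_distrib, ← add_smul]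
        congr 1
        refine Finset.sum_congr rfl fun i _ => ?_
        rw [← add_smul]
        congr 1
        ring
      map_smul' := fun r v => by
        simp only [ofCoords, frameCoord, real_inner_smul_left, RingHom.id_apply]
        rw [smul_add, smul_smul, Finset.smul_sum]
        congr 1
        refine Finset.sum_congr rfl fun i _ => ?_
        rw [smul_smul]
        congr 1
        ring }
  have hA (v : Space) : inner ℝ (A v) y = inner ℝ v x := h'.inner_ofCoords _ _
  have hA' (v : Space) (i : Fin 4) : inner ℝ (A v) (m i) = inner ℝ v (n i) := by
    rw [show inner ℝ (A v) (m i) = _ from h'.inner_ofCoords_nbr _ (h.sum_frameCoord v) i,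
      frameCoord]
    ring
  have hinner (v w : Space) : inner ℝ (A v) (A w) = inner ℝ v w := by
    rw [h'.inner_eq, h.inner_eq v w]
    simp only [frameCoord, hA, hA']
  refine ⟨(A.isometryOfInner hinner).toLinearIsometryEquiv rfl, ?_, fun i => ?_⟩
  · change A x = y
    refine h'.ext ?_ fun j => ?_
    · rw [hA, h.inner_self, h'.inner_self]
    · rw [hA', h.inner_nbr, h'.inner_nbr]
  · change A (n i) = m i
    refine h'.ext ?_ fun j => ?_
    · rw [hA, h.inner_nbr', h'.inner_nbr']
    · rw [hA', h.inner_nbr_nbr_eq, h'.inner_nbr_nbr_eq]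

theorem IsTight.image (hC : IsTight C) (O : Space ≃ₗᵢ[ℝ] Space) : IsTight (C.image O) where
  card_eq := by rw [Finset.card_image_of_injective _ O.injective, hC.card_eq]
  norm_eq x hx := by
    obtain ⟨x, hx', rfl⟩ := Finset.mem_image.1 hx
    rw [O.norm_map, hC.norm_eq x hx']
  inner_eq x hx y hy hxy := by
    obtain ⟨x, hx', rfl⟩ := Finset.mem_image.1 hx
    obtain ⟨y, hy', rfl⟩ := Finset.mem_image.1 hy
    rw [O.inner_map_map]
    exact hC.inner_eq x hx' y hy' fun h => hxy (h ▸ rfl)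
  moment_eq j x hx := by
    obtain ⟨x, hx', rfl⟩ := Finset.mem_image.1 hx
    rw [Finset.sum_image fun _ _ _ _ h => O.injective h]
    simp only [O.inner_map_map]
    exact hC.moment_eq j x hx'

/-- All tight configurations are congruent. -/
theorem IsTight.isOrthImage {D : Finset Space} (hD : IsTight D) (hC : IsTight C) :
    isOrthImage D C := by
  obtain ⟨x, hx⟩ := Finset.card_pos.1 (hD.card_eq ▸ by norm_num : 0 < D.card)
  obtain ⟨y, hy⟩ := Finset.card_pos.1 (hC.card_eq ▸ by norm_num : 0 < C.card)
  obtain ⟨n, hn, hnx⟩ := hD.exists_isFrame hx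
  obtain ⟨m, hm, hmy⟩ := hC.exists_isFrame hy
  obtain ⟨O, hOx, hOn⟩ := hn.exists_linearIsometryEquiv hm
  have hO := hD.image O
  refine ⟨O, (Finset.eq_of_subset_of_card_le ?_ (hC.card_eq.trans hO.card_eq.symm).le).symm⟩
  have hyO : y ∈ D.image O := hOx ▸ Finset.mem_image_of_mem O hx
  have hyC : nbrs (D.image O) y ⊆ C := by
    intro z hz
    obtain ⟨hz, hyz⟩ := mem_nbrs.1 hz
    obtain ⟨w, hw, rfl⟩ := Finset.mem_image.1 hz
    rw [← hOx, Near, O.inner_map_map] at hyz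
    obtain ⟨i, -, rfl⟩ := Finset.mem_image.1 (hnx ▸ mem_nbrs.2 ⟨hw, hyz⟩)
    rw [hOn]
    exact (mem_nbrs.1 (hmy ▸ Finset.mem_image_of_mem m (Finset.mem_univ i))).1
  have hsub := hO.subset_of_nbrs_subset
    (K := (D.image O).filter fun v => v ∈ C ∧ nbrs (D.image O) v ⊆ C) (Finset.filter_subset _ _)
    ⟨y, Finset.mem_filter.2 ⟨hyO, hy, hyC⟩⟩ fun v hv w hw => by
      obtain ⟨hvO, hvC, hv⟩ := Finset.mem_filter.1 hv
      exact Finset.mem_filter.2 ⟨(mem_nbrs.1 hw).1, hv hw, hC.nbrs_subset hO hvC hvO hv hw⟩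
  exact fun v hv => (Finset.mem_filter.1 (hsub hv)).2.1

end Local

/-- Theorem 5: the regular 120-cell is the unique global energy minimizer of `V120`
among 600-point configurations on `S³`. -/
theorem cell120_unique_ground_state :
    ∀ C : Finset (EuclideanSpace ℝ (Fin 4)), C.card = 600 → onSphere C →
      energy V120 cell120Config ≤ energy V120 C ∧
      (energy V120 C = energy V120 cell120Config → isOrthImage cell120Config C) := by
  exact fun C hcard hC => ⟨energy_cell120Config_le hcard hC, fun h =>
    isTight_cell120Config.isOrthImage (isTight_of_energy_eq hcard hC h)⟩
end

section
/- The function V : (0,2] → ℝ defined by V(r) = ∑_{i=1}^{17} c_i P_i(t) + ∑_{i=1}^{29} P_{m_i}(t)/10⁶ + 10⁵·q(t)²/(1−t), where t = 1 − r²/2 and P_i, q, m_i, c_i are as specified in the context, is strictly decreasing and strictly convex on (0,2]. -/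
/-! ### Integer polynomials as coefficient lists -/

namespace IntPoly

/-- The value at `x` of the polynomial with coefficients `l`, constant coefficient first. -/
noncomputable def eval : List ℤ → ℝ → ℝ
  | [], _ => 0
  | a :: l, x => a + x * eval l x

/-- Sum of two polynomials. -/
def add : List ℤ → List ℤ → List ℤ
  | [], m => m
  | a :: l, [] => a :: l
  | a :: l, b :: m => (a + b) :: add l m

/-- Scalar multiple of a polynomial. -/
def smul (c : ℤ) : List ℤ → List ℤ
  | [] => []
  | a :: l => (c * a) :: smul c l

/-- Product of two polynomials. -/
def mul : List ℤ → List ℤ → List ℤ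
  | [], _ => []
  | a :: l, m => add (smul a m) (0 :: mul l m)

/-- Derivative of a polynomial. -/
def der : List ℤ → List ℤ
  | [] => []
  | _ :: l => add l (0 :: der l)

/-- The substitution `x ↦ x + 1`. -/
def shift : List ℤ → List ℤ
  | [] => []
  | a :: l => add (a :: shift l) (shift l)

/-- The substitution `x ↦ x / 3`, up to a power of three that keeps the coefficients integral. -/
def third : List ℤ → List ℤ
  | [] => []
  | a :: l => ((3 ^ (l.length + 1) : ℕ) * a) :: third l

/-- Coefficientwise floor of the quotient of a polynomial by `d`. -/
def floorDiv (d : ℕ) : List ℤ → List ℤ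
  | [] => []
  | a :: l => (a / d) :: floorDiv d l

/-- The constant coefficient is positive and the other ones are nonnegative. -/
def signs : List ℤ → Bool
  | [] => false
  | a :: l => decide (0 < a) && l.all fun b => decide (0 ≤ b)

/-- A positivity test on `(0, 1]`: Descartes' rule of signs with at most `n`
levels of trisections. -/
def posTest : ℕ → List ℤ → Bool
  | 0, l => signs (shift l.reverse)
  | n + 1, l => signs (shift l.reverse) || (posTest n (third l) &&
      (posTest n (shift (third l)) && posTest n (shift (shift (third l)))))

lemma eval_add (l m : List ℤ) (x : ℝ) : eval (add l m) x = eval l x + eval m x := by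
  induction l generalizing m with
  | nil => simp [add, eval]
  | cons a l ih =>
    cases m with
    | nil => simp [add, eval]
    | cons b m => simp only [add, eval, ih]; push_cast; ring

lemma eval_smul (c : ℤ) (l : List ℤ) (x : ℝ) : eval (smul c l) x = c * eval l x := by
  induction l with
  | nil => simp [smul, eval]
  | cons a l ih => simp only [smul, eval, ih]; push_cast; ring

lemma eval_mul (l m : List ℤ) (x : ℝ) : eval (mul l m) x = eval l x * eval m x := by
  induction l with
  | nil => simp [mul, eval]
  | cons a l ih => simp only [mul, eval, eval_add, eval_smul, ih]; push_cast; ring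

lemma eval_shift (l : List ℤ) (x : ℝ) : eval (shift l) x = eval l (x + 1) := by
  induction l with
  | nil => simp [shift, eval]
  | cons a l ih => simp only [shift, eval, eval_add, ih]; ring

lemma eval_third (l : List ℤ) (x : ℝ) :
    eval (third l) x = 3 ^ l.length * eval l (x / 3) := by
  induction l with
  | nil => simp [third, eval]
  | cons a l ih => simp only [third, eval, ih, List.length_cons]; push_cast; ring

lemma mul_eval_floorDiv_le {d : ℕ} (hd : 0 < d) (l : List ℤ) {x : ℝ} (hx : 0 ≤ x) :
    d * eval (floorDiv d l) x ≤ eval l x := by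
  induction l with
  | nil => simp [floorDiv, eval]
  | cons a l ih =>
    have ha : (d : ℝ) * ((a / d : ℤ) : ℝ) ≤ a := by
      exact_mod_cast Int.mul_ediv_self_le (by exact_mod_cast hd.ne')
    simp only [floorDiv, eval]
    linear_combination ha + x * ih

lemma eval_append (l m : List ℤ) (x : ℝ) :
    eval (l ++ m) x = eval l x + x ^ l.length * eval m x := by
  induction l with
  | nil => simp [eval]
  | cons a l ih => simp only [List.cons_append, eval, ih, List.length_cons]; ring

lemma eval_reverse (l : List ℤ) {x : ℝ} (hx : x ≠ 0) :
    eval l.reverse x⁻¹ * x ^ l.length = x * eval l x := by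
  induction l with
  | nil => simp [eval]
  | cons a l ih =>
    have h : x⁻¹ ^ l.length * x ^ l.length = 1 := by
      rw [← mul_pow, inv_mul_cancel₀ hx, one_pow]
    simp only [List.reverse_cons, eval_append, eval, List.length_cons, List.length_reverse]
    linear_combination x * ih + a * x * h

lemma hasDerivAt_eval (l : List ℤ) (x : ℝ) : HasDerivAt (eval l) (eval (der l) x) x := by
  induction l with
  | nil => exact hasDerivAt_const x 0
  | cons a l ih =>
    refine (((hasDerivAt_id x).mul ih).const_add (a : ℝ)).congr_deriv ?_
    simp [der, eval_add, eval]

lemma eval_nonneg {l : List ℤ} (h : ∀ b ∈ l, 0 ≤ b) {x : ℝ} (hx : 0 ≤ x) : 0 ≤ eval l x := by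
  induction l with
  | nil => simp [eval]
  | cons a l ih =>
    have ha : (0 : ℝ) ≤ a := by exact_mod_cast h a (by simp)
    have := ih fun b hb => h b (by simp [hb])
    simp only [eval]
    positivity

lemma eval_pos_of_signs {l : List ℤ} (h : signs l = true) {x : ℝ} (hx : 0 ≤ x) :
    0 < eval l x := by
  cases l with
  | nil => simp [signs] at h
  | cons a l =>
    simp only [signs, Bool.and_eq_true, decide_eq_true_eq, List.all_eq_true] at h
    have ha : (0 : ℝ) < a := by exact_mod_cast h.1
    have := eval_nonneg h.2 hx
    simp only [eval]
    positivity

lemma eval_pos_of_signs_shift_reverse {l : List ℤ} (h : signs (shift l.reverse) = true)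
    {x : ℝ} (hx : 0 < x) (hx1 : x ≤ 1) : 0 < eval l x := by
  have h1 : 0 ≤ x⁻¹ - 1 := sub_nonneg.2 ((one_le_inv₀ hx).2 hx1)
  have h2 := eval_pos_of_signs h h1
  rw [eval_shift, sub_add_cancel] at h2
  have h3 : 0 < x * eval l x := by
    rw [← eval_reverse l hx.ne']
    positivity
  exact (mul_pos_iff_of_pos_left hx).1 h3

/-- A polynomial passing the positivity test is positive on `(0, 1]`. -/
lemma eval_pos_of_posTest {n : ℕ} {l : List ℤ} (h : posTest n l = true)
    {x : ℝ} (hx : 0 < x) (hx1 : x ≤ 1) : 0 < eval l x := by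
  induction n generalizing l x with
  | zero => exact eval_pos_of_signs_shift_reverse h hx hx1
  | succ n ih =>
    simp only [posTest, Bool.or_eq_true, Bool.and_eq_true] at h
    rcases h with h | ⟨h0, h1, h2⟩
    · exact eval_pos_of_signs_shift_reverse h hx hx1
    · have hpow : (0 : ℝ) < 3 ^ l.length := by positivity
      have hthird : eval (third l) (3 * x) = 3 ^ l.length * eval l x := by
        rw [eval_third, mul_div_cancel_left₀ x three_ne_zero]
      refine (mul_pos_iff_of_pos_left hpow).1 (hthird ▸ ?_)
      rcases le_or_gt (3 * x) 1 with hx2 | hx2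
      · exact ih h0 (by positivity) hx2
      rcases le_or_gt (3 * x) 2 with hx3 | hx3
      · have := ih h1 (x := 3 * x - 1) (by linarith) (by linarith)
        rwa [eval_shift, sub_add_cancel] at this
      · have := ih h2 (x := 3 * x - 1 - 1) (by linarith) (by linarith)
        rwa [eval_shift, eval_shift, sub_add_cancel, sub_add_cancel] at this

lemma eval_pos_of_posTest_floorDiv {n d : ℕ} {l : List ℤ} (hd : 0 < d)
    (h : posTest n (floorDiv d l) = true) {x : ℝ} (hx : 0 < x) (hx1 : x ≤ 1) : 0 < eval l x := by
  have h1 := eval_pos_of_posTest h hx hx1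
  have h2 : (0 : ℝ) < d := by exact_mod_cast hd
  exact (mul_pos h2 h1).trans_le (mul_eval_floorDiv_le hd l hx.le)

/-- The combination `∑ₖ wₖ uₖ`, where `u₀ = a`, `u₁ = b` and `u` satisfies the Chebyshev
recurrence at `1 - 2 * x`. -/
def chebyshevComb : List ℤ → List ℤ → List ℤ → List ℤ
  | [], _, _ => []
  | c :: w, a, b =>
    add (smul c a) (chebyshevComb w b (add (mul [2, -4] b) (smul (-1) a)))

/-- The combination `∑ₖ wₖ Uₙ₊ₖ(t)` of Chebyshev polynomials of the second kind. -/
noncomputable def chebyshevSum : List ℤ → ℕ → ℝ → ℝ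
  | [], _, _ => 0
  | c :: w, n, t =>
    c * (Polynomial.Chebyshev.U ℝ (n : ℤ)).eval t + chebyshevSum w (n + 1) t

lemma eval_chebyshevComb (w a b : List ℤ) (n : ℕ) (x : ℝ)
    (ha : eval a x = (Polynomial.Chebyshev.U ℝ (n : ℤ)).eval (1 - 2 * x))
    (hb : eval b x = (Polynomial.Chebyshev.U ℝ ((n + 1 : ℕ) : ℤ)).eval (1 - 2 * x)) :
    eval (chebyshevComb w a b) x = chebyshevSum w n (1 - 2 * x) := by
  induction w generalizing a b n with
  | nil => simp [chebyshevComb, chebyshevSum, eval]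
  | cons c w ih =>
    rw [chebyshevComb, chebyshevSum, eval_add, eval_smul, ha, ih _ _ (n + 1) hb]
    have hrec : Polynomial.Chebyshev.U ℝ ((n + 1 + 1 : ℕ) : ℤ) =
        2 * Polynomial.X * Polynomial.Chebyshev.U ℝ ((n + 1 : ℕ) : ℤ) -
          Polynomial.Chebyshev.U ℝ (n : ℤ) := by
      have := Polynomial.Chebyshev.U_add_two ℝ (n : ℤ)
      push_cast
      rw [add_assoc]
      exact this
    rw [eval_add, eval_mul, eval_smul, ha, hb, hrec]
    simp only [eval, Polynomial.eval_sub, Polynomial.eval_mul, Polynomial.eval_X,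
      Polynomial.eval_ofNat]
    push_cast
    ring

/-- The combination governing the second derivative of `r ↦ f(r² / 4) / r²`. -/
def convexity (l : List ℤ) : List ℤ :=
  add (smul 2 (0 :: 0 :: der (der l))) (add (smul (-3) (0 :: der l)) (smul 3 l))

/-- The combination governing the derivative of `r ↦ f(r² / 4) / r²`. -/
def decrease (l : List ℤ) : List ℤ := add l (smul (-1) (0 :: der l))

lemma eval_convexity (l : List ℤ) (x : ℝ) :
    eval (convexity l) x =
      2 * x ^ 2 * eval (der (der l)) x - 3 * x * eval (der l) x + 3 * eval l x := by
  simp only [convexity, eval_add, eval_smul, eval]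
  push_cast
  ring

lemma eval_decrease (l : List ℤ) (x : ℝ) :
    eval (decrease l) x = eval l x - x * eval (der l) x := by
  simp only [decrease, eval_add, eval_smul, eval]
  push_cast
  ring

lemma hasDerivAt_eval_sq (l : List ℤ) (r : ℝ) :
    HasDerivAt (fun s => eval l (s ^ 2 / 4)) (eval (der l) (r ^ 2 / 4) * (r / 2)) r := by
  have h : HasDerivAt (fun s : ℝ => s ^ 2 / 4) (r / 2) r :=
    ((hasDerivAt_pow 2 r).div_const 4).congr_deriv (by norm_num; ring)
  exact (hasDerivAt_eval l (r ^ 2 / 4)).comp r h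

lemma hasDerivAt_eval_sq_div_sq (l : List ℤ) {r : ℝ} (hr : r ≠ 0) :
    HasDerivAt (fun s => eval l (s ^ 2 / 4) / s ^ 2)
      (-2 * eval (decrease l) (r ^ 2 / 4) / r ^ 3) r := by
  refine ((hasDerivAt_eval_sq l r).div (hasDerivAt_pow 2 r) (pow_ne_zero 2 hr)).congr_deriv ?_
  rw [eval_decrease]
  field_simp
  push_cast
  ring

lemma hasDerivAt_deriv_eval_sq_div_sq (l : List ℤ) {r : ℝ} (hr : r ≠ 0) :
    HasDerivAt (deriv fun s => eval l (s ^ 2 / 4) / s ^ 2)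
      (2 * eval (convexity l) (r ^ 2 / 4) / r ^ 4) r := by
  have h : HasDerivAt (fun s => -2 * (eval l (s ^ 2 / 4) - s ^ 2 / 4 *
      eval (der l) (s ^ 2 / 4)) / s ^ 3) (2 * eval (convexity l) (r ^ 2 / 4) / r ^ 4) r := by
    have hsq : HasDerivAt (fun s : ℝ => s ^ 2 / 4) (r / 2) r :=
      ((hasDerivAt_pow 2 r).div_const 4).congr_deriv (by norm_num; ring)
    refine ((((hasDerivAt_eval_sq l r).sub (hsq.mul (hasDerivAt_eval_sq (der l) r))).const_mul
      (-2)).div (hasDerivAt_pow 3 r) (pow_ne_zero 3 hr)).congr_deriv ?_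
    rw [eval_convexity]
    simp only [Pi.sub_apply, Pi.mul_apply]
    field_simp
    push_cast
    ring
  refine h.congr_of_eventuallyEq ?_
  filter_upwards [isOpen_ne.mem_nhds hr] with s hs
  rw [(hasDerivAt_eval_sq_div_sq l hs).deriv, eval_decrease]

lemma strictAntiOn_of_posTest {l : List ℤ} {n d : ℕ} (hd : 0 < d)
    (h : posTest n (floorDiv d (decrease l)) = true) :
    StrictAntiOn (fun r => eval l (r ^ 2 / 4) / r ^ 2) (Set.Ioc 0 2) := by
  refine strictAntiOn_of_deriv_neg (convex_Ioc 0 2)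
    (fun r hr => (hasDerivAt_eval_sq_div_sq l hr.1.ne').continuousAt.continuousWithinAt) ?_
  intro r hr
  rw [interior_Ioc] at hr
  obtain ⟨h0, h2⟩ := hr
  rw [(hasDerivAt_eval_sq_div_sq l h0.ne').deriv, neg_mul, neg_div, neg_lt_zero]
  have := eval_pos_of_posTest_floorDiv hd h (x := r ^ 2 / 4) (by positivity) (by nlinarith)
  positivity

lemma strictConvexOn_of_posTest {l : List ℤ} {n d : ℕ} (hd : 0 < d)
    (h : posTest n (floorDiv d (convexity l)) = true) :
    StrictConvexOn ℝ (Set.Ioc 0 2) (fun r => eval l (r ^ 2 / 4) / r ^ 2) := by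
  refine strictConvexOn_of_deriv2_pos (convex_Ioc 0 2)
    (fun r hr => (hasDerivAt_eval_sq_div_sq l hr.1.ne').continuousAt.continuousWithinAt) ?_
  intro r hr
  rw [interior_Ioc] at hr
  obtain ⟨h0, h2⟩ := hr
  rw [Function.iterate_succ_apply, Function.iterate_one,
    (hasDerivAt_deriv_eval_sq_div_sq l h0.ne').deriv]
  have := eval_pos_of_posTest_floorDiv hd h (x := r ^ 2 / 4) (by positivity) (by nlinarith)
  positivity

end IntPoly

open IntPoly

/-! ### The 120-cell potential -/

/-- The coefficients of the Chebyshev polynomials of the second kind in the Gegenbauer part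
of `W120`, multiplied by their common denominator. -/
def gegenWeights120 : List ℤ := [
  0, 10946731891880945160, 4865216606773963440, 2432610127840472580, 1094676473204378064,
  405437757986981720, 156384855422555760, 136836748494736290, 162176076236654480,
  145958468612989032, 89566070773299120, 28808984835490860, 0, 12164587089677880,
  36490529379992688, 39096800287118145, 20335754001522960, 4268943766327240, 1152286415280,
  1094672094516, 0, 995156449560, 951888777840, 912226745430, 0, 842055457320, 810868218160,
  781908638940, 754946272080, 729781396344, 0, 0, 0, 0, 625526911152, 0, 0, 0, 561370304880, 0,
  0, 0, 0, 0, 0, 0, 465817912560]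

/-- The coefficients of `2 ^ 50 * q120 (1 - 2 * x)`. -/
def qCoeffs120 : List ℤ :=
  [[1, -2], [2, -2], [5, -8], [3, -8], [7, -8], [1, -8], [3, -4], [1, -4], [11, -64, 64],
    [5, -20, 16], [1, -12, 16], [19, -72, 64], [11, -56, 64], [9, -72, 64], [1, -56, 64],
    [29, -88, 64], [5, -40, 64], [41, -104, 64], [1, -24, 64]].foldr mul [1]

/-- The coefficients of the numerator of `W120 (1 - 2 * x)`. -/
def vCoeffs120 : List ℤ := [
  328701608813585656385055970150500000000000000000,
  56779804642025817219413558242166609692230120898560,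
  11744280584919259281245360611533121189791217618124800,
  -1196558008786813493599462368872120460904266416667492352,
  75529918712214646441189175752795513817617160442663665664,
  -3494364868284974470224256935197572587709520226711861460992,
  125948495446096865768889882230501800921958123306831503687680,
  -3670030143594730632018567603962115878027169435075326760714240,
  88674469852218332045754158000874548756555590045391607732109312,
  -1810204684946628811410119358866171601574268922430339486679302144,
  31683704451170456506211101816280221198841215388961033742033354752,
  -481165098416166616317882462684746192845091863835271744459940823040,
  6403020985615532389291993679030771670264308685362905275177023569920,
  -75284491446387077931496135798940502680007357459329783941576544747520,
  787598199663028825353568905392566863757822585740248488873257536061440,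
  -7375331104792962424779870657798469483142151755447015345817423498444800,
  62138395910646892005450831087280340540096669832890138048250531324887040,
  -473096255263200308121440404400655770042856397691078657120524333828014080,
  3267341449795538159980661274442375021450737167153010524324395529189457920,
  -20536083647378584569885272123249095908627819277812864044956260129350615040,
  117802727498907200120241683876067566273516949037738140443491737302602874880,
  -618283856607698624801755186066367950976723968021198451727066635278913372160,
  2975520458503184223156627238273410506654597313732838899676673149736992112640,
  -13155692530572598898242868224512947967624529477246099929042945091173351424000,
  53526965433142010037417921021322207922606165272589710776394773076870011289600,
  -200715466952206581450931744099579878316823377264921935758028329118700299878400,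
  694536507321504564958943301665092695020398601111616021431859020711583463505920,
  -2220200918162498892730938714097842709335278767234962374053079995718394676510720,
  6562554040808943116797389294593282175271845974741341492884252710356704659767296,
  -17949950412385914847732468652297784896980813747494193945572122132144964230971392,
  45458727573148271392872928379951897236874000826981110894657994797224753643913216,
  -106639390020460801405206047872845988708478489540860900896058454422168650299473920,
  231780309662797558217991453685119765064268877244414147127064166635758523399536640,
  -466805184050568371201616859132664415578455102824537903999341598291140987748089856,
  871095591441532829311235489049857925080659488623435422782246366562484146019500032,
  -1505793575892654333913440300840885887945116861902493747389362315195273455626878976,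
  2410229763488074510031248863679349547171280259965441767150042415785398934479831040,
  -3570186003937337060778579306848517524413530223241444609624715645670318333860249600,
  4890195180608016553515220615734594453367071193008126840796289203638704400110714880,
  -6187847568314581102394051168274241014164559419705050457617252364358349914101514240,
  7224537691934203283428433983536608652162217651518565908499379738686757728262553600,
  -7771604592500301408513002168274360767635606823566542641197064097954340464513515520,
  7689474190321375159128301345017106856749178006581912065826546521350615107412951040,
  -6983767867568229728395659091890384715794796896232770750888149221678854298486702080,
  5808442510275254849400916190659571833366101354958780419182291910245497924327833600,
  -4411633500579114166401742008871931740168350912671368207098797503877977432758681600,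
  3049965515702806962567783302504747194901235695399005021359756313904961488462807040,
  -1911989588697225513596715495382540331635007741498333152775429424130573977759252480,
  1081962963453769910201639437593856427261478028912926222642340178165760000000000000,
  -549731055207806631205859228739061016111719566630325980593979119370240000000000000,
  249181029272721215151834749459115811240100870415525245660000554057728000000000000,
  -99985116384187086392174997678214427195837238364826339398840108449792000000000000,
  35177973056816316858346072081818888146804836893224310896125733240832000000000000,
  -10723640085652237867972962731450901804939974371583876381237607137280000000000000,
  2789448028920378613503112845849631354285466546112925798557762453504000000000000,
  -606798899671905571943044373500488729198565693827767470723669426176000000000000,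
  107369508701731415859871880971641099520177133245324952895536234496000000000000,
  -14841748164345673238295648416848967066291492094985660459049287680000000000000,
  1503173214003964870924331217749043467678771142383072382138974208000000000000,
  -99191633625486140621096026608597826111710302218054134443016192000000000000,
  3199730116951165826486968600277349229410009748969488207839232000000000000]

lemma vCoeffs120_eq :
    vCoeffs120 = add (smul (2 ^ 101) (0 :: chebyshevComb gegenWeights120 [1] [2, -4]))
      (smul (21893441890320000000 * 10 ^ 5) (mul qCoeffs120 qCoeffs120)) := by
  decide +kernel

lemma posTest_decrease_vCoeffs120 :
    posTest 2 (floorDiv (10 ^ 40) (decrease vCoeffs120)) = true := by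
  decide +kernel

lemma posTest_convexity_vCoeffs120 :
    posTest 3 (floorDiv (10 ^ 40) (convexity vCoeffs120)) = true := by
  decide +kernel

lemma gegenbauer_sum_eq_chebyshevSum (t : ℝ) :
    (∑ i ∈ Finset.Icc 1 17, c120 i * gegenP i t) + (∑ j : Fin 29, gegenP (m120 j) t / 10 ^ 6) =
      chebyshevSum gegenWeights120 0 t / 21893441890320000000 := by
  have h : Finset.Icc 1 17 = {1, 2, 3, 4, 5, 6, 7, 8, 9, 10, 11, 12, 13, 14, 15, 16, 17} := by
    decide
  rw [h]
  simp only [gegenWeights120, chebyshevSum, gegenP, Fin.sum_univ_succ, m120, c120]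
  simp
  ring

lemma eval_qCoeffs120 (x : ℝ) : eval qCoeffs120 x = 2 ^ 50 * q120 (1 - 2 * x) := by
  simp only [qCoeffs120, List.foldr, eval_mul, q120, mul_div_assoc']
  rw [mul_div_cancel_left₀ _ (by positivity)]
  simp only [eval]
  push_cast
  ring

lemma exists_V120_eq :
    ∃ c : ℝ, 0 < c ∧ ∀ r ≠ 0, V120 r = c * (eval vCoeffs120 (r ^ 2 / 4) / r ^ 2) := by
  refine ⟨4 / (2 ^ 101 * 21893441890320000000), by positivity, fun r hr => ?_⟩
  have hU : eval (chebyshevComb gegenWeights120 [1] [2, -4]) (r ^ 2 / 4) =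
      chebyshevSum gegenWeights120 0 (1 - 2 * (r ^ 2 / 4)) := by
    apply eval_chebyshevComb
    · simp [eval]
    · simp [eval]
      ring
  have ht : 1 - r ^ 2 / 2 = 1 - 2 * (r ^ 2 / 4) := by ring
  rw [V120, W120, gegenbauer_sum_eq_chebyshevSum, vCoeffs120_eq, eval_add, eval_smul, eval_smul,
    eval_mul, eval_qCoeffs120, eval, hU, ht]
  generalize chebyshevSum gegenWeights120 0 (1 - 2 * (r ^ 2 / 4)) = s
  generalize q120 (1 - 2 * (r ^ 2 / 4)) = q
  rw [show 1 - (1 - 2 * (r ^ 2 / 4)) = r ^ 2 / 2 by ring]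
  push_cast
  field_simp
  ring

/-- The 120-cell potential is strictly decreasing and strictly convex on `(0, 2]`. -/
theorem V120_strictAnti_strictConvex :
    StrictAntiOn V120 (Set.Ioc 0 2) ∧ StrictConvexOn ℝ (Set.Ioc 0 2) V120 := by
  obtain ⟨c, hc, hV⟩ := exists_V120_eq
  have heq : Set.EqOn (fun r => c * (eval vCoeffs120 (r ^ 2 / 4) / r ^ 2)) V120
      (Set.Ioc 0 2) := fun r hr => (hV r hr.1.ne').symm
  constructor
  · refine StrictAntiOn.congr (fun a ha b hb hab => ?_) heq
    exact mul_lt_mul_of_pos_left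
      (strictAntiOn_of_posTest (by positivity) posTest_decrease_vCoeffs120 ha hb hab) hc
  · refine StrictConvexOn.congr ⟨convex_Ioc 0 2, fun a ha b hb hab α β hα hβ hαβ => ?_⟩ heq
    have := mul_lt_mul_of_pos_left
      ((strictConvexOn_of_posTest (by positivity) posTest_convexity_vCoeffs120).2 ha hb hab hα hβ hαβ) hc
    simp only [smul_eq_mul] at this ⊢
    linarith
end
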